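/- arXiv:2210.17046 — 6 statements merged into one kernel-verified Lean document; each statement's English description precedes it below -/
import Mathlib

section
/- The dual cone of the forward-setup cone is the Minkowski sum of the positive semidefinite cone and the orthogonal complement of L_f: a Hermitian operator W on H_{A_I}⊗H_{A_O}⊗H_{B_I}⊗H_{B_O} satisfies Tr(W·Y) ≥ 0 for every positive semidefinite Y ∈ L_f if and only if there exists a Hermitian operator W₂ with Tr(W₂·Y') = 0 for every Hermitian Y' ∈ L_f such that W − W₂ is positive semidefinite. -/
open Matrix
open scoped ComplexOrder

namespace InOutIndef

/-- Index set of `H_{A_I} ⊗ H_{A_O} ⊗ H_{B_I} ⊗ H_{B_O}`, with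
`dim H_{A_I} = dim H_{A_O} = dA`, `dim H_{B_I} = dBI`, `dim H_{B_O} = dBO`. -/
abbrev Idx4 (dA dBI dBO : ℕ) := Fin dA × Fin dA × Fin dBI × Fin dBO

/-- Operators on `H_{A_I} ⊗ H_{A_O} ⊗ H_{B_I} ⊗ H_{B_O}`. -/
abbrev Mat4 (dA dBI dBO : ℕ) := Matrix (Idx4 dA dBI dBO) (Idx4 dA dBI dBO) ℂ

variable (dA dBI dBO : ℕ)

/-- Partial trace `Tr_{A_I A_O B_O}`. -/
noncomputable def trAIAOBO (M : Mat4 dA dBI dBO) : Matrix (Fin dBI) (Fin dBI) ℂ :=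
  Matrix.of fun bi bi' => ∑ ai : Fin dA, ∑ ao : Fin dA, ∑ bo : Fin dBO,
    M (ai, ao, bi, bo) (ai, ao, bi', bo)

/-- Partial trace `Tr_{B_O}`. -/
noncomputable def trBO (M : Mat4 dA dBI dBO) :
    Matrix (Fin dA × Fin dA × Fin dBI) (Fin dA × Fin dA × Fin dBI) ℂ :=
  Matrix.of fun p q => ∑ bo : Fin dBO, M (p.1, p.2.1, p.2.2, bo) (q.1, q.2.1, q.2.2, bo)

/-- Partial trace `Tr_{A_O B_O}` (remaining factors: `A_I`, `B_I`). -/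
noncomputable def trAOBO (M : Mat4 dA dBI dBO) :
    Matrix (Fin dA × Fin dBI) (Fin dA × Fin dBI) ℂ :=
  Matrix.of fun p q => ∑ ao : Fin dA, ∑ bo : Fin dBO, M (p.1, ao, p.2, bo) (q.1, ao, q.2, bo)

/-- Partial trace `Tr_{A_I B_O}` (remaining factors: `A_O`, `B_I`). -/
noncomputable def trAIBO (M : Mat4 dA dBI dBO) :
    Matrix (Fin dA × Fin dBI) (Fin dA × Fin dBI) ℂ :=
  Matrix.of fun p q => ∑ ai : Fin dA, ∑ bo : Fin dBO, M (ai, p.1, p.2, bo) (ai, q.1, q.2, bo)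

/-- `L_V := {X : Tr_{A_I A_O B_O}(X) = (Tr(X)/d_{B_I})·I_{B_I}}`. -/
def LV : Set (Mat4 dA dBI dBO) :=
  {X | trAIAOBO dA dBI dBO X =
    (X.trace / (dBI : ℂ)) • (1 : Matrix (Fin dBI) (Fin dBI) ℂ)}

/-- `L_f := {Y : Tr_{B_O}(Y) = Tr_{A_O B_O}(Y) ⊗ I_{A_O}/d_A}` (factors reinserted in
their original positions). -/
def LF : Set (Mat4 dA dBI dBO) :=
  {Y | trBO dA dBI dBO Y = Matrix.of fun p q =>
    trAOBO dA dBI dBO Y (p.1, p.2.2) (q.1, q.2.2) *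
      (if p.2.1 = q.2.1 then ((dA : ℂ))⁻¹ else 0)}

/-- `L_b := {Z : Tr_{B_O}(Z) = Tr_{A_I B_O}(Z) ⊗ I_{A_I}/d_A}` (factors reinserted in
their original positions). -/
def LB : Set (Mat4 dA dBI dBO) :=
  {Z | trBO dA dBI dBO Z = Matrix.of fun p q =>
    trAIBO dA dBI dBO Z (p.2.1, p.2.2) (q.2.1, q.2.2) *
      (if p.1 = q.1 then ((dA : ℂ))⁻¹ else 0)}

/-- The cone of definite-input-output-direction setups,
`coni(S_definite) := {X + Y : X ∈ P∩L_V∩L_f, Y ∈ P∩L_V∩L_b}`. -/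
def coniSdefinite : Set (Mat4 dA dBI dBO) :=
  {S | ∃ X Y : Mat4 dA dBI dBO,
    X.PosSemidef ∧ X ∈ LV dA dBI dBO ∧ X ∈ LF dA dBI dBO ∧
    Y.PosSemidef ∧ Y ∈ LV dA dBI dBO ∧ Y ∈ LB dA dBI dBO ∧
    S = X + Y}

end InOutIndef

namespace InOutIndef

open scoped MatrixOrder Matrix.Norms.L2Operator in
/-- Adding a large multiple of the identity makes a Hermitian matrix positive semidefinite. -/
lemma exists_posSemidef_smul_one_add {n : Type*} [Fintype n] [DecidableEq n]
    {A : Matrix n n ℂ} (hA : A.IsHermitian) :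
    ∃ c : ℝ, (c • (1 : Matrix n n ℂ) + A).PosSemidef := by
  refine ⟨‖A‖, ?_⟩
  have h := IsSelfAdjoint.neg_algebraMap_norm_le_self (a := A) hA
  rw [Matrix.le_iff, Algebra.algebraMap_eq_smul_one, sub_neg_eq_add, add_comm] at h
  exact h

open scoped MatrixOrder in
lemma trace_mul_nonneg_of_posSemidef {n : Type*} [Fintype n]
    {A B : Matrix n n ℂ} (hA : A.PosSemidef) (hB : B.PosSemidef) : 0 ≤ (A * B).trace := by
  classical
  obtain ⟨C, rfl⟩ := CStarAlgebra.nonneg_iff_eq_star_mul_self.mp hA.nonneg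
  rw [Matrix.mul_assoc, Matrix.trace_mul_comm]
  exact (hB.mul_mul_conjTranspose_same C).trace_nonneg

lemma conj_trace_mul_of_isHermitian {n : Type*} [Fintype n]
    {A B : Matrix n n ℂ} (hA : A.IsHermitian) (hB : B.IsHermitian) :
    star (A * B).trace = (A * B).trace := by
  rw [← Matrix.trace_conjTranspose, Matrix.conjTranspose_mul, hA.eq, hB.eq,
    Matrix.trace_mul_comm]

lemma im_trace_mul_of_isHermitian {n : Type*} [Fintype n]
    {A B : Matrix n n ℂ} (hA : A.IsHermitian) (hB : B.IsHermitian) :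
    (A * B).trace.im = 0 :=
  Complex.conj_eq_iff_im.mp (conj_trace_mul_of_isHermitian hA hB)

/-- Every real functional on Hermitian matrices is the trace pairing with a Hermitian matrix. -/
lemma exists_isHermitian_re_trace_mul {n : Type*} [Fintype n] [DecidableEq n]
    (g : selfAdjoint (Matrix n n ℂ) →ₗ[ℝ] ℝ) :
    ∃ G : Matrix n n ℂ, G.IsHermitian ∧
      ∀ X : selfAdjoint (Matrix n n ℂ), (G * (X : Matrix n n ℂ)).trace.re = g X := by
  let φ : Module.Dual ℂ (Matrix n n ℂ) := Module.Dual.extendRCLike (g ∘ₗ realPart)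
  let F : Matrix n n ℂ := Matrix.of fun i j => φ (Matrix.single j i 1)
  have hF : ∀ M, (F * M).trace = φ M := by
    intro M
    conv_rhs => rw [Matrix.matrix_eq_sum_single M]
    simp only [map_sum, Matrix.trace, Matrix.diag, Matrix.mul_apply]
    rw [Finset.sum_comm]
    refine Finset.sum_congr rfl fun i _ => Finset.sum_congr rfl fun j _ => ?_
    have : Matrix.single i j (M i j) = M i j • Matrix.single i j (1 : ℂ) := by
      simp [Matrix.smul_single]
    rw [this, map_smul, smul_eq_mul, mul_comm]
    rfl
  have hre : ∀ X : selfAdjoint (Matrix n n ℂ), (F * (X : Matrix n n ℂ)).trace.re = g X := by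
    intro X
    have h := Module.Dual.re_extendRCLike_apply (𝕜 := ℂ) (g ∘ₗ realPart) (X : Matrix n n ℂ)
    rw [hF]
    refine h.trans ?_
    simp
  refine ⟨(1 / 2 : ℝ) • (F + Fᴴ), ?_, fun X => ?_⟩
  · simp [Matrix.IsHermitian, Matrix.conjTranspose_smul, add_comm]
  · have hX : (X : Matrix n n ℂ)ᴴ = X := X.2
    have hconj : (Fᴴ * (X : Matrix n n ℂ)).trace.re = g X := by
      have h : Fᴴ * (X : Matrix n n ℂ) = ((X : Matrix n n ℂ) * F)ᴴ := by
        rw [Matrix.conjTranspose_mul, hX]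
      rw [h, Matrix.trace_conjTranspose, Matrix.trace_mul_comm, ← hre X]
      simp
    rw [Matrix.smul_mul, Matrix.trace_smul, Complex.smul_re, Matrix.add_mul, Matrix.trace_add,
      Complex.add_re, hre, hconj, smul_eq_mul]
    ring

/-- The cone of positive semidefinite matrices inside the real space of Hermitian matrices. -/
def posSemidefCone (n : Type*) [Fintype n] : PointedCone ℝ (selfAdjoint (Matrix n n ℂ)) where
  carrier := {X | (X : Matrix n n ℂ).PosSemidef}
  add_mem' hX hY := Matrix.PosSemidef.add hX hY
  zero_mem' := Matrix.PosSemidef.zero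
  smul_mem' c _ hX := Matrix.PosSemidef.smul hX c.2

/-- Conic duality for a real subspace of matrices containing the identity: the dual cone of its
positive semidefinite part is the sum of the positive semidefinite cone and the annihilator of its
Hermitian part. -/
theorem trace_mul_nonneg_iff_exists_sub_posSemidef {n : Type*} [Fintype n] [DecidableEq n]
    (L : Submodule ℝ (Matrix n n ℂ)) (hone : 1 ∈ L) {W : Matrix n n ℂ} (hW : W.IsHermitian) :
    (∀ Y : Matrix n n ℂ, Y.PosSemidef → Y ∈ L → 0 ≤ (W * Y).trace) ↔
      ∃ W₂ : Matrix n n ℂ, W₂.IsHermitian ∧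
        (∀ Y : Matrix n n ℂ, Y.IsHermitian → Y ∈ L → (W₂ * Y).trace = 0) ∧
        (W - W₂).PosSemidef := by
  constructor
  · intro h
    let f : selfAdjoint (Matrix n n ℂ) →ₗ[ℝ] ℝ :=
      Complex.reLm ∘ₗ Matrix.traceLinearMap n ℝ ℂ ∘ₗ LinearMap.mulLeft ℝ W ∘ₗ
        (selfAdjoint.submodule ℝ (Matrix n n ℂ)).subtype
    let D : Submodule ℝ (selfAdjoint (Matrix n n ℂ)) :=
      L.comap (selfAdjoint.submodule ℝ (Matrix n n ℂ)).subtype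
    obtain ⟨g, hgf, hg⟩ := riesz_extension (posSemidefCone n) ⟨D, f ∘ₗ D.subtype⟩
      (fun X hX => (Complex.le_def.mp (h _ hX X.2)).1)
      (fun X => by
        obtain ⟨c, hc⟩ := exists_posSemidef_smul_one_add (A := (X : Matrix n n ℂ)) X.2
        exact ⟨⟨c • 1, L.smul_mem c hone⟩, hc⟩)
    obtain ⟨G, hG, hGg⟩ := exists_isHermitian_re_trace_mul g
    refine ⟨W - G, hW.sub hG, fun Y hY hYL => ?_, ?_⟩
    · have hre : (G * Y).trace.re = (W * Y).trace.re :=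
        (hGg ⟨Y, hY⟩).trans (hgf ⟨⟨Y, hY⟩, hYL⟩)
      apply Complex.ext
      · simp [Matrix.sub_mul, Matrix.trace_sub, hre]
      · exact im_trace_mul_of_isHermitian (hW.sub hG) hY
    · rw [sub_sub_cancel]
      refine .of_dotProduct_mulVec_nonneg hG fun x => ?_
      have hx := Matrix.posSemidef_vecMulVec_self_star x
      have htr : (G * Matrix.vecMulVec x (star x)).trace = star x ⬝ᵥ G *ᵥ x := by
        rw [Matrix.mul_vecMulVec, Matrix.trace_vecMulVec, dotProduct_comm]
      rw [← htr, Complex.le_def]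
      refine ⟨?_, (im_trace_mul_of_isHermitian hG hx.1).symm⟩
      exact (hg ⟨_, hx.1⟩ hx).trans_eq (hGg ⟨_, hx.1⟩).symm
  · rintro ⟨W₂, -, horth, hpos⟩ Y hY hYL
    have h := trace_mul_nonneg_of_posSemidef hpos hY
    rwa [Matrix.sub_mul, Matrix.trace_sub, horth Y hY.1 hYL, sub_zero] at h

/-- `LF` as a real subspace. -/
noncomputable def LFSubmodule (dA dBI dBO : ℕ) : Submodule ℝ (Mat4 dA dBI dBO) where
  carrier := LF dA dBI dBO
  add_mem' {X Y} hX hY := by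
    ext p q
    have h₁ := congrFun₂ hX p q
    have h₂ := congrFun₂ hY p q
    simp only [trBO, trAOBO, Matrix.of_apply, Matrix.add_apply, Finset.sum_add_distrib,
      add_mul] at h₁ h₂ ⊢
    rw [h₁, h₂]
  zero_mem' := by
    ext p q
    simp [trBO, trAOBO]
  smul_mem' c X hX := by
    ext p q
    have h := congrFun₂ hX p q
    simp only [trBO, trAOBO, Matrix.of_apply, Matrix.smul_apply, ← Finset.smul_sum,
      smul_mul_assoc] at h ⊢
    rw [h]

lemma one_mem_LF {dA : ℕ} (dBI dBO : ℕ) (hdA : 1 ≤ dA) : 1 ∈ LF dA dBI dBO := by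
  have h : (dA : ℂ) ≠ 0 := by exact_mod_cast (Nat.one_le_iff_ne_zero.mp hdA)
  ext ⟨i, j, k⟩ ⟨i', j', k'⟩
  by_cases hi : i = i' <;> by_cases hj : j = j' <;> by_cases hk : k = k' <;>
    simp [trBO, trAOBO, Matrix.one_apply, hi, hj, hk]
  field_simp

/-- **Dual cone of the forward-setup cone.** A Hermitian operator `W` on
`H_{A_I}⊗H_{A_O}⊗H_{B_I}⊗H_{B_O}` satisfies `Tr(W·Y) ≥ 0` for every positive
semidefinite `Y ∈ L_f` if and only if there exists a Hermitian `W₂` with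
`Tr(W₂·Y') = 0` for every Hermitian `Y' ∈ L_f` such that `W − W₂` is positive
semidefinite; that is, the dual cone of `P ∩ L_f` is `P + L_f^⊥`. -/
theorem dual_cone_forward (dA dBI dBO : ℕ) (hdA : 1 ≤ dA)
    (W : Mat4 dA dBI dBO) (hW : W.IsHermitian) :
    (∀ Y : Mat4 dA dBI dBO, Y.PosSemidef → Y ∈ LF dA dBI dBO → 0 ≤ (W * Y).trace) ↔
    (∃ W₂ : Mat4 dA dBI dBO, W₂.IsHermitian ∧
      (∀ Y' : Mat4 dA dBI dBO, Y'.IsHermitian → Y' ∈ LF dA dBI dBO →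
        (W₂ * Y').trace = 0) ∧
      (W - W₂).PosSemidef) := by
  exact trace_mul_nonneg_iff_exists_sub_posSemidef (LFSubmodule dA dBI dBO)
    (one_mem_LF dBI dBO hdA) hW

end InOutIndef
end

section
/- Let S be a Hermitian operator on H_{A_I}⊗H_{A_O}⊗H_{B_I}⊗H_{B_O} with S ∈ L_s ∩ L_V and Hilbert–Schmidt norm ‖S‖₂ ≤ 1/2. Then I + S belongs to coni(S_definite); explicitly, I + S = S_f + S_b where S_f := I/2 + ⌊S⌋_{A_O} lies in P∩L_V∩L_f and S_b := I/2 + S − ⌊S⌋_{A_O} lies in P∩L_V∩L_b. -/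
open Matrix
open scoped ComplexOrder

namespace InOutIndef

variable (dA dBI dBO : ℕ)

/-- `⌊S⌋_{A_O}`: trace out `A_O` and reinsert the normalized identity `I_{A_O}/d_A`. -/
noncomputable def floorAO (M : Mat4 dA dBI dBO) : Mat4 dA dBI dBO :=
  Matrix.of fun p q =>
    (if p.2.1 = q.2.1 then ((dA : ℂ))⁻¹ else 0) *
      ∑ x : Fin dA, M (p.1, x, p.2.2.1, p.2.2.2) (q.1, x, q.2.2.1, q.2.2.2)

/-- `⌊S⌋_{B_O}`: trace out `B_O` and reinsert the normalized identity `I_{B_O}/d_{B_O}`. -/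
noncomputable def floorBO (M : Mat4 dA dBI dBO) : Mat4 dA dBI dBO :=
  Matrix.of fun p q =>
    (if p.2.2.2 = q.2.2.2 then ((dBO : ℂ))⁻¹ else 0) *
      ∑ y : Fin dBO, M (p.1, p.2.1, p.2.2.1, y) (q.1, q.2.1, q.2.2.1, y)

/-- `⌊S⌋_{B_O A_O}`: trace out `B_O` and `A_O`, reinserting normalized identities. -/
noncomputable def floorBOAO (M : Mat4 dA dBI dBO) : Mat4 dA dBI dBO :=
  Matrix.of fun p q =>
    (if p.2.1 = q.2.1 then ((dA : ℂ))⁻¹ else 0) *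
      (if p.2.2.2 = q.2.2.2 then ((dBO : ℂ))⁻¹ else 0) *
      ∑ x : Fin dA, ∑ y : Fin dBO, M (p.1, x, p.2.2.1, y) (q.1, x, q.2.2.1, y)

/-- `⌊S⌋_{B_O A_I}`: trace out `B_O` and `A_I`, reinserting normalized identities. -/
noncomputable def floorBOAI (M : Mat4 dA dBI dBO) : Mat4 dA dBI dBO :=
  Matrix.of fun p q =>
    (if p.1 = q.1 then ((dA : ℂ))⁻¹ else 0) *
      (if p.2.2.2 = q.2.2.2 then ((dBO : ℂ))⁻¹ else 0) *
      ∑ x : Fin dA, ∑ y : Fin dBO, M (x, p.2.1, p.2.2.1, y) (x, q.2.1, q.2.2.1, y)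

/-- `⌊S⌋_{B_O A_O A_I}`: trace out `B_O`, `A_O` and `A_I`, reinserting normalized
identities. -/
noncomputable def floorBOAOAI (M : Mat4 dA dBI dBO) : Mat4 dA dBI dBO :=
  Matrix.of fun p q =>
    (if p.1 = q.1 then ((dA : ℂ))⁻¹ else 0) *
      (if p.2.1 = q.2.1 then ((dA : ℂ))⁻¹ else 0) *
      (if p.2.2.2 = q.2.2.2 then ((dBO : ℂ))⁻¹ else 0) *
      ∑ x : Fin dA, ∑ x' : Fin dA, ∑ y : Fin dBO,
        M (x, x', p.2.2.1, y) (x, x', q.2.2.1, y)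

/-- `L_s := {S : ⌊S⌋_{B_O} = ⌊S⌋_{B_O A_O} + ⌊S⌋_{B_O A_I} − ⌊S⌋_{B_O A_O A_I}}`. -/
def LS : Set (Mat4 dA dBI dBO) :=
  {S | floorBO dA dBI dBO S =
    floorBOAO dA dBI dBO S + floorBOAI dA dBI dBO S - floorBOAOAI dA dBI dBO S}

/-- The Hilbert–Schmidt (Frobenius) norm `‖S‖₂ := √(Tr(SᴴS))`. -/
noncomputable def hsNorm {ι : Type*} [Fintype ι] (M : Matrix ι ι ℂ) : ℝ :=
  Real.sqrt ((Mᴴ * M).trace.re)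

end InOutIndef

namespace InOutIndef

/-- A Hermitian matrix of squared Frobenius norm at most `1/4` becomes positive semidefinite after
adding half of the identity. -/
theorem posSemidef_half_add {ι : Type*} [Fintype ι] [DecidableEq ι] {M : Matrix ι ι ℂ}
    (hM : M.IsHermitian) (hn : ∑ i, ∑ j, ‖M i j‖ ^ 2 ≤ 1 / 4) :
    ((2 : ℂ)⁻¹ • 1 + M).PosSemidef := by
  have hH : ((2 : ℂ)⁻¹ • 1 + M).IsHermitian := by
    refine IsHermitian.add ?_ hM
    simp [IsHermitian, conjTranspose_smul]
  refine PosSemidef.of_dotProduct_mulVec_nonneg hH fun x => ?_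
  have him := hH.im_star_dotProduct_mulVec_self x
  rw [Complex.nonneg_iff]
  refine ⟨?_, him.symm⟩
  set N : ℝ := ∑ i, ‖x i‖ ^ 2 with hN
  have hN0 : 0 ≤ N := by positivity
  have hxx : star x ⬝ᵥ x = (N : ℂ) := by
    simp [dotProduct, hN, Complex.conj_mul']
  have hexp : star x ⬝ᵥ M *ᵥ x = ∑ p : ι × ι, star (x p.1) * M p.1 p.2 * x p.2 := by
    simp [dotProduct, mulVec, Finset.mul_sum, Fintype.sum_prod_type, mul_assoc]
  have hcs : ‖star x ⬝ᵥ M *ᵥ x‖ ≤ N / 2 := by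
    have h1 : ‖star x ⬝ᵥ M *ᵥ x‖ ≤ ∑ p : ι × ι, ‖M p.1 p.2‖ * (‖x p.1‖ * ‖x p.2‖) := by
      rw [hexp]
      refine (norm_sum_le _ _).trans (le_of_eq (Finset.sum_congr rfl fun p _ => ?_))
      rw [norm_mul, norm_mul, norm_star]
      ring
    have h2 := Finset.sum_mul_sq_le_sq_mul_sq Finset.univ
      (fun p : ι × ι => ‖M p.1 p.2‖) (fun p => ‖x p.1‖ * ‖x p.2‖)
    have h3 : ∑ p : ι × ι, (‖x p.1‖ * ‖x p.2‖) ^ 2 = N * N := by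
      simp [hN, Fintype.sum_prod_type, mul_pow, Finset.sum_mul_sum]
    rw [h3, Fintype.sum_prod_type (fun p : ι × ι => ‖M p.1 p.2‖ ^ 2)] at h2
    refine h1.trans (abs_le_of_sq_le_sq' ?_ (by positivity)).2
    nlinarith [mul_nonneg hN0 hN0]
  have hre := (abs_le.1 (Complex.abs_re_le_norm (star x ⬝ᵥ M *ᵥ x))).1
  rw [add_mulVec, smul_mulVec, one_mulVec, dotProduct_add, dotProduct_smul, hxx]
  have : ((2 : ℂ)⁻¹ • (N : ℂ)).re = N / 2 := by
    have : ((2 : ℂ)⁻¹ • (N : ℂ)) = ((N / 2 : ℝ) : ℂ) := by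
      push_cast; rw [smul_eq_mul]; ring
    rw [this, Complex.ofReal_re]
  rw [Complex.add_re, this]
  linarith

/-- The squared Hilbert–Schmidt norm is the sum of the squared moduli of the entries. -/
theorem hsNorm_sq {ι : Type*} [Fintype ι] (M : Matrix ι ι ℂ) :
    hsNorm M ^ 2 = ∑ i, ∑ j, ‖M i j‖ ^ 2 := by
  have h : (Mᴴ * M).trace = ((∑ i, ∑ j, ‖M i j‖ ^ 2 : ℝ) : ℂ) := by
    simp only [trace, diag, mul_apply, conjTranspose_apply]
    rw [Finset.sum_comm]
    push_cast
    simp [Complex.conj_mul']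
  rw [hsNorm, h, Complex.ofReal_re, Real.sq_sqrt (by positivity)]

/-- Pythagoras for the splitting of a square matrix into its normalized trace part and its
traceless part. -/
theorem sum_norm_sq_trace_split {d : ℕ} (hd : (d : ℂ) ≠ 0) (A : Fin d → Fin d → ℂ) :
    ∑ x : Fin d, ∑ y : Fin d, ‖(if x = y then (d : ℂ)⁻¹ else 0) * ∑ z, A z z‖ ^ 2 +
      ∑ x : Fin d, ∑ y : Fin d, ‖A x y - (if x = y then (d : ℂ)⁻¹ else 0) * ∑ z, A z z‖ ^ 2 =
    ∑ x, ∑ y, ‖A x y‖ ^ 2 := by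
  set t := ∑ z, A z z with ht
  have hpt : ∀ x y, ‖(if x = y then (d : ℂ)⁻¹ else 0) * t‖ ^ 2 +
      ‖A x y - (if x = y then (d : ℂ)⁻¹ else 0) * t‖ ^ 2 = ‖A x y‖ ^ 2 +
      if x = y then 2 * (((d : ℂ)⁻¹ * t - A x x) * star ((d : ℂ)⁻¹ * t)).re else 0 := by
    intro x y
    split_ifs with h
    · subst h
      simp only [← Complex.normSq_eq_norm_sq, Complex.normSq_apply, Complex.sub_re,
        Complex.sub_im, Complex.mul_re, Complex.star_def, Complex.conj_re, Complex.conj_im]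
      ring
    · simp
  simp only [← Finset.sum_add_distrib, hpt]
  simp only [Finset.sum_add_distrib, Finset.sum_ite_eq, Finset.mem_univ, if_true]
  rw [← Finset.mul_sum, ← Complex.re_sum, ← Finset.sum_mul, Finset.sum_sub_distrib, ← ht]
  simp [hd]

theorem floorAO_mk {dA dBI dBO : ℕ} (S : Mat4 dA dBI dBO) (a x a' x' : Fin dA) (b b' : Fin dBI)
    (c c' : Fin dBO) : floorAO dA dBI dBO S (a, x, b, c) (a', x', b', c') =
      (if x = x' then (dA : ℂ)⁻¹ else 0) * ∑ y, S (a, y, b, c) (a', y, b', c') :=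
  rfl

theorem sum_norm_sq_floorAO_split {dA dBI dBO : ℕ} (hd : (dA : ℂ) ≠ 0) (S : Mat4 dA dBI dBO) :
    ∑ p, ∑ q, ‖floorAO dA dBI dBO S p q‖ ^ 2 +
      ∑ p, ∑ q, ‖(S - floorAO dA dBI dBO S) p q‖ ^ 2 = ∑ p, ∑ q, ‖S p q‖ ^ 2 := by
  have reorder : ∀ f : Idx4 dA dBI dBO → Idx4 dA dBI dBO → ℝ, ∑ p, ∑ q, f p q =
      ∑ r : Fin dA × Fin dBI × Fin dBO, ∑ s : Fin dA × Fin dBI × Fin dBO, ∑ x, ∑ y,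
        f (r.1, x, r.2) (s.1, y, s.2) := by
    intro f
    have one : ∀ g : Idx4 dA dBI dBO → ℝ, ∑ p, g p =
        ∑ r : Fin dA × Fin dBI × Fin dBO, ∑ x, g (r.1, x, r.2) := by
      intro g
      simp only [Fintype.sum_prod_type]
      refine Finset.sum_congr rfl fun a _ => ?_
      rw [Finset.sum_comm]
      exact Finset.sum_congr rfl fun b _ => Finset.sum_comm
    simp only [one]
    exact Finset.sum_congr rfl fun r _ => Finset.sum_comm
  simp only [reorder,
    ← Finset.sum_add_distrib (s := (Finset.univ : Finset (Fin dA × Fin dBI × Fin dBO)))]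
  refine Finset.sum_congr rfl fun r _ => Finset.sum_congr rfl fun s _ => ?_
  exact sum_norm_sq_trace_split hd fun x y => S (r.1, x, r.2) (s.1, y, s.2)

theorem floorAO_isHermitian {dA dBI dBO : ℕ} {S : Mat4 dA dBI dBO} (hS : S.IsHermitian) :
    (floorAO dA dBI dBO S).IsHermitian := by
  refine IsHermitian.ext fun p q => ?_
  simp only [floorAO, of_apply, star_mul', star_sum, hS.apply, eq_comm (a := q.2.1)]
  split_ifs <;> simp

theorem half_add_mem_LV {dA dBI dBO : ℕ} (hd : (dBI : ℂ) ≠ 0) {M : Mat4 dA dBI dBO}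
    (hM : M ∈ LV dA dBI dBO) : (2 : ℂ)⁻¹ • 1 + M ∈ LV dA dBI dBO := by
  have h : trAIAOBO dA dBI dBO M = _ := hM
  change trAIAOBO dA dBI dBO _ = _
  ext b b'
  have h' := congrFun₂ h b b'
  simp only [trAIAOBO, of_apply, Matrix.smul_apply, smul_eq_mul] at h'
  simp only [trAIAOBO, of_apply, Matrix.add_apply, Matrix.smul_apply, smul_eq_mul,
    Finset.sum_add_distrib, h', trace_add, trace_smul, trace_one, one_apply, Prod.mk.injEq,
    true_and, and_true]
  split_ifs
  · simp
    field_simp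
  · simp

theorem trAIAOBO_floorAO {dA dBI dBO : ℕ} (hd : (dA : ℂ) ≠ 0) (S : Mat4 dA dBI dBO) :
    trAIAOBO dA dBI dBO (floorAO dA dBI dBO S) = trAIAOBO dA dBI dBO S := by
  ext b b'
  simp only [trAIAOBO, floorAO_mk, of_apply, if_true, ← Finset.mul_sum, Finset.sum_const,
    Finset.card_univ, Fintype.card_fin, nsmul_eq_mul]
  rw [inv_mul_cancel_left₀ hd]
  refine Finset.sum_congr rfl fun a _ => ?_
  rw [Finset.sum_comm]

theorem trace_eq_trace_trAIAOBO {dA dBI dBO : ℕ} (S : Mat4 dA dBI dBO) :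
    S.trace = (trAIAOBO dA dBI dBO S).trace := by
  simp only [trace, diag, trAIAOBO, of_apply, Fintype.sum_prod_type]
  rw [Finset.sum_comm (s := (Finset.univ : Finset (Fin dBI)))]
  refine Finset.sum_congr rfl fun a _ => ?_
  rw [Finset.sum_comm (s := (Finset.univ : Finset (Fin dBI)))]

theorem floorAO_mem_LV {dA dBI dBO : ℕ} (hd : (dA : ℂ) ≠ 0) {S : Mat4 dA dBI dBO}
    (hS : S ∈ LV dA dBI dBO) : floorAO dA dBI dBO S ∈ LV dA dBI dBO := by
  have h : trAIAOBO dA dBI dBO S = _ := hS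
  change trAIAOBO dA dBI dBO _ = _
  rw [trace_eq_trace_trAIAOBO, trAIAOBO_floorAO hd, ← trace_eq_trace_trAIAOBO, h]

theorem sub_mem_LV {dA dBI dBO : ℕ} {M N : Mat4 dA dBI dBO}
    (hM : M ∈ LV dA dBI dBO) (hN : N ∈ LV dA dBI dBO) : M - N ∈ LV dA dBI dBO := by
  have h : trAIAOBO dA dBI dBO M = _ := hM
  have h' : trAIAOBO dA dBI dBO N = _ := hN
  change trAIAOBO dA dBI dBO _ = _
  rw [trace_sub, sub_div, sub_smul, ← h, ← h']
  ext b b'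
  simp [trAIAOBO]

theorem half_add_mem_LF {dA dBI dBO : ℕ} (hd : (dA : ℂ) ≠ 0) {M : Mat4 dA dBI dBO}
    (hM : M ∈ LF dA dBI dBO) : (2 : ℂ)⁻¹ • 1 + M ∈ LF dA dBI dBO := by
  have h : trBO dA dBI dBO M = _ := hM
  change trBO dA dBI dBO _ = _
  ext ⟨a, x, b⟩ ⟨a', x', b'⟩
  have h' := congrFun₂ h (a, x, b) (a', x', b')
  simp only [trBO, trAOBO, of_apply] at h'
  simp only [trBO, trAOBO, of_apply, Matrix.add_apply, Matrix.smul_apply, smul_eq_mul,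
    Finset.sum_add_distrib, h', add_mul, add_left_inj, one_apply, Prod.mk.injEq,
    true_and, and_true]
  by_cases ha : a = a' <;> by_cases hx : x = x' <;> by_cases hb : b = b' <;> simp [*]
  field_simp

theorem half_add_mem_LB {dA dBI dBO : ℕ} (hd : (dA : ℂ) ≠ 0) {M : Mat4 dA dBI dBO}
    (hM : M ∈ LB dA dBI dBO) : (2 : ℂ)⁻¹ • 1 + M ∈ LB dA dBI dBO := by
  have h : trBO dA dBI dBO M = _ := hM
  change trBO dA dBI dBO _ = _
  ext ⟨a, x, b⟩ ⟨a', x', b'⟩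
  have h' := congrFun₂ h (a, x, b) (a', x', b')
  simp only [trBO, trAIBO, of_apply] at h'
  simp only [trBO, trAIBO, of_apply, Matrix.add_apply, Matrix.smul_apply, smul_eq_mul,
    Finset.sum_add_distrib, h', add_mul, add_left_inj, one_apply, Prod.mk.injEq,
    true_and, and_true]
  by_cases ha : a = a' <;> by_cases hx : x = x' <;> by_cases hb : b = b' <;> simp [*]
  field_simp

theorem floorAO_mem_LF {dA dBI dBO : ℕ} (hd : (dA : ℂ) ≠ 0) (S : Mat4 dA dBI dBO) :
    floorAO dA dBI dBO S ∈ LF dA dBI dBO := by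
  change trBO dA dBI dBO _ = _
  ext ⟨a, x, b⟩ ⟨a', x', b'⟩
  simp only [trBO, trAOBO, floorAO_mk, of_apply, if_true, ← Finset.mul_sum, Finset.sum_const,
    Finset.card_univ, Fintype.card_fin, nsmul_eq_mul, inv_mul_cancel_left₀ hd]
  rw [mul_comm]

theorem sub_floorAO_mem_LB {dA dBI dBO : ℕ} (hdBO : (dBO : ℂ) ≠ 0)
    {S : Mat4 dA dBI dBO} (hS : S ∈ LS dA dBI dBO) :
    S - floorAO dA dBI dBO S ∈ LB dA dBI dBO := by
  have h : floorBO dA dBI dBO S = _ := hS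
  change trBO dA dBI dBO _ = _
  have : NeZero dBO := ⟨by exact_mod_cast hdBO⟩
  ext ⟨a, x, b⟩ ⟨a', x', b'⟩
  have h' := congrFun₂ h (a, x, b, 0) (a', x', b', 0)
  simp only [floorBO, floorBOAO, floorBOAI, floorBOAOAI, Matrix.sub_apply,
    Matrix.add_apply, of_apply, if_true] at h'
  simp only [trBO, trAIBO, floorAO_mk, Matrix.sub_apply, of_apply, Finset.sum_sub_distrib,
    ← Finset.mul_sum]
  rw [Finset.sum_comm (s := (Finset.univ : Finset (Fin dBO)))]
  have hc : ∑ i : Fin dA, ∑ j : Fin dBO, ∑ k : Fin dA, S (i, k, b, j) (i, k, b', j) =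
      ∑ i : Fin dA, ∑ k : Fin dA, ∑ j : Fin dBO, S (i, k, b, j) (i, k, b', j) :=
    Finset.sum_congr rfl fun i _ => Finset.sum_comm
  rw [hc]
  refine mul_left_cancel₀ (inv_ne_zero hdBO) ?_
  rw [mul_sub, h']
  ring

/-- **Lemma (robust interior point).** If `S` is a Hermitian operator in `L_s ∩ L_V`
with Hilbert–Schmidt norm `‖S‖₂ ≤ 1/2`, then `I + S ∈ coni(S_definite)`; explicitly,
`I + S = S_f + S_b` with `S_f := I/2 + ⌊S⌋_{A_O} ∈ P∩L_V∩L_f` and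
`S_b := I/2 + S − ⌊S⌋_{A_O} ∈ P∩L_V∩L_b`. -/
theorem id_add_small_mem_coniSdefinite (dA dBI dBO : ℕ)
    (hdA : 1 ≤ dA) (hdBI : 1 ≤ dBI) (hdBO : 1 ≤ dBO)
    (S : Mat4 dA dBI dBO) (hS : S.IsHermitian)
    (hLs : S ∈ LS dA dBI dBO) (hLV : S ∈ LV dA dBI dBO)
    (hnorm : hsNorm S ≤ 1 / 2) :
    (1 + S) ∈ coniSdefinite dA dBI dBO ∧
    1 + S = (((2 : ℂ))⁻¹ • 1 + floorAO dA dBI dBO S) +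
      (((2 : ℂ))⁻¹ • 1 + S - floorAO dA dBI dBO S) ∧
    (((2 : ℂ))⁻¹ • 1 + floorAO dA dBI dBO S).PosSemidef ∧
    (((2 : ℂ))⁻¹ • 1 + floorAO dA dBI dBO S) ∈ LV dA dBI dBO ∧
    (((2 : ℂ))⁻¹ • 1 + floorAO dA dBI dBO S) ∈ LF dA dBI dBO ∧
    (((2 : ℂ))⁻¹ • 1 + S - floorAO dA dBI dBO S).PosSemidef ∧
    (((2 : ℂ))⁻¹ • 1 + S - floorAO dA dBI dBO S) ∈ LV dA dBI dBO ∧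
    (((2 : ℂ))⁻¹ • 1 + S - floorAO dA dBI dBO S) ∈ LB dA dBI dBO := by
  have hA : (dA : ℂ) ≠ 0 := by exact_mod_cast (by lia : dA ≠ 0)
  have hBI : (dBI : ℂ) ≠ 0 := by exact_mod_cast (by lia : dBI ≠ 0)
  have hBO : (dBO : ℂ) ≠ 0 := by exact_mod_cast (by lia : dBO ≠ 0)
  have hsq : ∑ p, ∑ q, ‖S p q‖ ^ 2 ≤ 1 / 4 := by
    rw [← hsNorm_sq]
    have h0 : 0 ≤ hsNorm S := Real.sqrt_nonneg _
    nlinarith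
  have hsplit := sum_norm_sq_floorAO_split hA S
  have hF0 : 0 ≤ ∑ p, ∑ q, ‖floorAO dA dBI dBO S p q‖ ^ 2 := by positivity
  have hG0 : 0 ≤ ∑ p, ∑ q, ‖(S - floorAO dA dBI dBO S) p q‖ ^ 2 := by positivity
  have hFH := floorAO_isHermitian hS
  have hFV := floorAO_mem_LV hA hLV
  have hsum : 1 + S = ((2 : ℂ)⁻¹ • 1 + floorAO dA dBI dBO S) +
      ((2 : ℂ)⁻¹ • 1 + S - floorAO dA dBI dBO S) := by
    have h1 : (1 : Mat4 dA dBI dBO) = (2 : ℂ)⁻¹ • 1 + (2 : ℂ)⁻¹ • 1 := by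
      rw [← add_smul, ← two_mul, mul_inv_cancel₀ two_ne_zero, one_smul]
    nth_rewrite 1 [h1]
    abel
  have hFP := posSemidef_half_add hFH (by linarith)
  have hGP := posSemidef_half_add (hS.sub hFH) (by linarith)
  have hFV' := half_add_mem_LV hBI hFV
  have hGV' := half_add_mem_LV hBI (sub_mem_LV hLV hFV)
  have hFF := half_add_mem_LF hA (floorAO_mem_LF hA S)
  have hGB := half_add_mem_LB hA (sub_floorAO_mem_LB hBO hLs)
  rw [← add_sub_assoc] at hGP hGV' hGB
  exact ⟨⟨_, _, hFP, hFV', hFF, hGP, hGV', hGB, hsum⟩, hsum, hFP, hFV', hFF, hGP, hGV', hGB⟩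

end InOutIndef
end

section
/- Let S be a Hermitian operator on H_{A_I}⊗H_{A_O}⊗H_{B_I}⊗H_{B_O}⊗H_{C_I}⊗H_{C_O}. Then the following are equivalent: (i) for every Choi operator N₁ of a bistochastic channel on the pair (A_I, A_O) and every Choi operator N₂ of a bistochastic channel on the pair (B_I, B_O), one has Tr_{A_I A_O B_I B_O C_O}[ S · (N₁ ⊗ N₂ ⊗ I_{C_I C_O})ᵀ ] = I_{C_I}; (ii) S satisfies Tr_{A_I A_O B_I B_O C_O}(S) = d_A·d_B·I_{C_I}, ⌊Δ_{A_I}Δ_{A_O}(S)⌋_{B_I B_O C_O} = 0, ⌊Δ_{B_I}Δ_{B_O}(S)⌋_{A_I A_O C_O} = 0, and ⌊Δ_{A_I}Δ_{A_O}Δ_{B_I}Δ_{B_O}(S)⌋_{C_O} = 0. -/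
open Matrix
open scoped ComplexOrder

namespace BipartiteSupermap

/-- Index set of `H_{A_I}⊗H_{A_O}⊗H_{B_I}⊗H_{B_O}⊗H_{C_I}⊗H_{C_O}`. -/
abbrev Idx6 (dA dB dCI dCO : ℕ) :=
  Fin dA × Fin dA × Fin dB × Fin dB × Fin dCI × Fin dCO

/-- Operators on the six-factor tensor product. -/
abbrev Mat6 (dA dB dCI dCO : ℕ) :=
  Matrix (Idx6 dA dB dCI dCO) (Idx6 dA dB dCI dCO) ℂ

/-- Partial trace over the input (first) factor of an (in, out) pair. -/
noncomputable def ptrIn {d : ℕ} (N : Matrix (Fin d × Fin d) (Fin d × Fin d) ℂ) :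
    Matrix (Fin d) (Fin d) ℂ :=
  Matrix.of fun o o' => ∑ i : Fin d, N (i, o) (i, o')

/-- Partial trace over the output (second) factor of an (in, out) pair. -/
noncomputable def ptrOut {d : ℕ} (N : Matrix (Fin d × Fin d) (Fin d × Fin d) ℂ) :
    Matrix (Fin d) (Fin d) ℂ :=
  Matrix.of fun i i' => ∑ o : Fin d, N (i, o) (i', o)

/-- Choi operator of a bistochastic channel: positive semidefinite with
`Tr_out(N) = I_in` and `Tr_in(N) = I_out`. -/
def IsBistochasticChoi {d : ℕ} (N : Matrix (Fin d × Fin d) (Fin d × Fin d) ℂ) : Prop :=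
  N.PosSemidef ∧ ptrOut N = 1 ∧ ptrIn N = 1

variable (dA dB dCI dCO : ℕ)

/-- The operator `N₁ ⊗ N₂ ⊗ I_{C_I C_O}` on the six-factor space, with `N₁` in the
slots `(A_I, A_O)`, `N₂` in the slots `(B_I, B_O)`, and the identity on `C_I ⊗ C_O`. -/
noncomputable def embed (N₁ : Matrix (Fin dA × Fin dA) (Fin dA × Fin dA) ℂ)
    (N₂ : Matrix (Fin dB × Fin dB) (Fin dB × Fin dB) ℂ) : Mat6 dA dB dCI dCO :=
  Matrix.of fun p q =>
    N₁ (p.1, p.2.1) (q.1, q.2.1) *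
    N₂ (p.2.2.1, p.2.2.2.1) (q.2.2.1, q.2.2.2.1) *
    (if p.2.2.2.2.1 = q.2.2.2.2.1 then 1 else 0) *
    (if p.2.2.2.2.2 = q.2.2.2.2.2 then 1 else 0)

/-- Partial trace `Tr_{A_I A_O B_I B_O C_O}`, leaving an operator on `C_I`. -/
noncomputable def trToCI (M : Mat6 dA dB dCI dCO) : Matrix (Fin dCI) (Fin dCI) ℂ :=
  Matrix.of fun ci ci' =>
    ∑ ai : Fin dA, ∑ ao : Fin dA, ∑ bi : Fin dB, ∑ bo : Fin dB, ∑ co : Fin dCO,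
      M (ai, ao, bi, bo, ci, co) (ai, ao, bi, bo, ci', co)

/-- `⌊M⌋_{A_I}`: trace out `A_I`, reinsert `I_{A_I}/d_A`. -/
noncomputable def floorAI (M : Mat6 dA dB dCI dCO) : Mat6 dA dB dCI dCO :=
  Matrix.of fun p q =>
    (if p.1 = q.1 then ((dA : ℂ))⁻¹ else 0) *
      ∑ x : Fin dA,
        M (x, p.2.1, p.2.2.1, p.2.2.2.1, p.2.2.2.2.1, p.2.2.2.2.2)
          (x, q.2.1, q.2.2.1, q.2.2.2.1, q.2.2.2.2.1, q.2.2.2.2.2)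

/-- `⌊M⌋_{A_O}`: trace out `A_O`, reinsert `I_{A_O}/d_A`. -/
noncomputable def floorAO (M : Mat6 dA dB dCI dCO) : Mat6 dA dB dCI dCO :=
  Matrix.of fun p q =>
    (if p.2.1 = q.2.1 then ((dA : ℂ))⁻¹ else 0) *
      ∑ x : Fin dA,
        M (p.1, x, p.2.2.1, p.2.2.2.1, p.2.2.2.2.1, p.2.2.2.2.2)
          (q.1, x, q.2.2.1, q.2.2.2.1, q.2.2.2.2.1, q.2.2.2.2.2)

/-- `⌊M⌋_{B_I}`: trace out `B_I`, reinsert `I_{B_I}/d_B`. -/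
noncomputable def floorBI (M : Mat6 dA dB dCI dCO) : Mat6 dA dB dCI dCO :=
  Matrix.of fun p q =>
    (if p.2.2.1 = q.2.2.1 then ((dB : ℂ))⁻¹ else 0) *
      ∑ x : Fin dB,
        M (p.1, p.2.1, x, p.2.2.2.1, p.2.2.2.2.1, p.2.2.2.2.2)
          (q.1, q.2.1, x, q.2.2.2.1, q.2.2.2.2.1, q.2.2.2.2.2)

/-- `⌊M⌋_{B_O}`: trace out `B_O`, reinsert `I_{B_O}/d_B`. -/
noncomputable def floorBO (M : Mat6 dA dB dCI dCO) : Mat6 dA dB dCI dCO :=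
  Matrix.of fun p q =>
    (if p.2.2.2.1 = q.2.2.2.1 then ((dB : ℂ))⁻¹ else 0) *
      ∑ x : Fin dB,
        M (p.1, p.2.1, p.2.2.1, x, p.2.2.2.2.1, p.2.2.2.2.2)
          (q.1, q.2.1, q.2.2.1, x, q.2.2.2.2.1, q.2.2.2.2.2)

/-- `⌊M⌋_{C_O}`: trace out `C_O`, reinsert `I_{C_O}/d_{C_O}`. -/
noncomputable def floorCO (M : Mat6 dA dB dCI dCO) : Mat6 dA dB dCI dCO :=
  Matrix.of fun p q =>
    (if p.2.2.2.2.2 = q.2.2.2.2.2 then ((dCO : ℂ))⁻¹ else 0) *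
      ∑ x : Fin dCO,
        M (p.1, p.2.1, p.2.2.1, p.2.2.2.1, p.2.2.2.2.1, x)
          (q.1, q.2.1, q.2.2.1, q.2.2.2.1, q.2.2.2.2.1, x)

/-- `Δ_{A_I}(M) := M − ⌊M⌋_{A_I}`. -/
noncomputable def deltaAI (M : Mat6 dA dB dCI dCO) : Mat6 dA dB dCI dCO :=
  M - floorAI dA dB dCI dCO M

/-- `Δ_{A_O}(M) := M − ⌊M⌋_{A_O}`. -/
noncomputable def deltaAO (M : Mat6 dA dB dCI dCO) : Mat6 dA dB dCI dCO :=
  M - floorAO dA dB dCI dCO M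

/-- `Δ_{B_I}(M) := M − ⌊M⌋_{B_I}`. -/
noncomputable def deltaBI (M : Mat6 dA dB dCI dCO) : Mat6 dA dB dCI dCO :=
  M - floorBI dA dB dCI dCO M

/-- `Δ_{B_O}(M) := M − ⌊M⌋_{B_O}`. -/
noncomputable def deltaBO (M : Mat6 dA dB dCI dCO) : Mat6 dA dB dCI dCO :=
  M - floorBO dA dB dCI dCO M

section Pair

/-- Operators on an (in, out) pair of systems of dimension `d`. -/
abbrev PairMat (d : ℕ) := Matrix (Fin d × Fin d) (Fin d × Fin d) ℂ

variable {d : ℕ}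

/-- Trace out the input factor of a pair and reinsert the normalized identity. -/
noncomputable def floorIn (X : PairMat d) : PairMat d :=
  Matrix.of fun p q => (if p.1 = q.1 then (d : ℂ)⁻¹ else 0) * ptrIn X p.2 q.2

/-- Trace out the output factor of a pair and reinsert the normalized identity. -/
noncomputable def floorOut (X : PairMat d) : PairMat d :=
  Matrix.of fun p q => (if p.2 = q.2 then (d : ℂ)⁻¹ else 0) * ptrOut X p.1 q.1

/-- The map `Δ_out Δ_in` on a pair. -/
noncomputable def deltaPair (X : PairMat d) : PairMat d :=
  X - floorIn X - floorOut (X - floorIn X)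

theorem ptrOut_add (X Y : PairMat d) : ptrOut (X + Y) = ptrOut X + ptrOut Y := by
  ext; simp [ptrOut, Finset.sum_add_distrib]

theorem ptrIn_add (X Y : PairMat d) : ptrIn (X + Y) = ptrIn X + ptrIn Y := by
  ext; simp [ptrIn, Finset.sum_add_distrib]

theorem ptrOut_sub (X Y : PairMat d) : ptrOut (X - Y) = ptrOut X - ptrOut Y := by
  ext; simp [ptrOut, Finset.sum_sub_distrib]

theorem ptrIn_sub (X Y : PairMat d) : ptrIn (X - Y) = ptrIn X - ptrIn Y := by
  ext; simp [ptrIn, Finset.sum_sub_distrib]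

/-- Operators on a pair whose two partial traces vanish. -/
def marginalFree (d : ℕ) : Submodule ℂ (PairMat d) where
  carrier := {X | ptrOut X = 0 ∧ ptrIn X = 0}
  zero_mem' := by constructor <;> ext <;> simp [ptrOut, ptrIn]
  add_mem' := by
    rintro X Y ⟨hX, hX'⟩ ⟨hY, hY'⟩
    constructor
    · rw [ptrOut_add, hX, hY, add_zero]
    · rw [ptrIn_add, hX', hY', add_zero]
  smul_mem' := by
    rintro c X ⟨hX, hX'⟩
    constructor
    · rw [show ptrOut (c • X) = c • ptrOut X by
        ext; simp [ptrOut, Finset.mul_sum], hX, smul_zero]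
    · rw [show ptrIn (c • X) = c • ptrIn X by
        ext; simp [ptrIn, Finset.mul_sum], hX', smul_zero]

theorem conjTranspose_mem_marginalFree {X : PairMat d} (hX : X ∈ marginalFree d) :
    Xᴴ ∈ marginalFree d := by
  obtain ⟨h₁, h₂⟩ := hX
  constructor
  · rw [show ptrOut Xᴴ = (ptrOut X)ᴴ by ext; simp [ptrOut], h₁, conjTranspose_zero]
  · rw [show ptrIn Xᴴ = (ptrIn X)ᴴ by ext; simp [ptrIn], h₂, conjTranspose_zero]

theorem ptrIn_floorIn (hd : 1 ≤ d) (X : PairMat d) : ptrIn (floorIn X) = ptrIn X := by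
  have : (d : ℂ) ≠ 0 := by exact_mod_cast (by omega : d ≠ 0)
  ext
  simp [ptrIn, floorIn, this]

theorem ptrOut_floorOut (hd : 1 ≤ d) (X : PairMat d) : ptrOut (floorOut X) = ptrOut X := by
  have : (d : ℂ) ≠ 0 := by exact_mod_cast (by omega : d ≠ 0)
  ext
  simp [ptrOut, floorOut, this]

theorem ptrIn_floorOut_eq_zero {X : PairMat d} (hX : ptrIn X = 0) : ptrIn (floorOut X) = 0 := by
  ext o o'
  have h (x : Fin d) : ∑ i, X (i, x) (i, x) = 0 := congrFun (congrFun hX x) x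
  have h' : ∑ i, ptrOut X i i = 0 := by
    simp only [ptrOut, of_apply]
    rw [Finset.sum_comm]
    simp [h]
  by_cases ho : o = o' <;> simp [ptrIn, floorOut, ho, ← Finset.mul_sum, h']

theorem deltaPair_mem_marginalFree (hd : 1 ≤ d) (X : PairMat d) :
    deltaPair X ∈ marginalFree d := by
  have h : ptrIn (X - floorIn X) = 0 := by rw [ptrIn_sub, ptrIn_floorIn hd, sub_self]
  constructor
  · rw [deltaPair, ptrOut_sub, ptrOut_floorOut hd, sub_self]
  · rw [deltaPair, ptrIn_sub, h, ptrIn_floorOut_eq_zero h, sub_zero]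

theorem deltaPair_eq_self {X : PairMat d} (hX : X ∈ marginalFree d) : deltaPair X = X := by
  have h₁ : floorIn X = 0 := by ext; simp [floorIn, hX.2]
  have h₂ : floorOut X = 0 := by ext; simp [floorOut, hX.1]
  simp [deltaPair, h₁, h₂]

theorem floorOut_floorIn (X : PairMat d) :
    floorOut (floorIn X) = ((d : ℂ)⁻¹ * (d : ℂ)⁻¹ * X.trace) • 1 := by
  ext p q
  obtain ⟨i, o⟩ := p
  obtain ⟨i', o'⟩ := q
  have : X.trace = ∑ o, ∑ i, X (i, o) (i, o) := by
    rw [Matrix.trace, Fintype.sum_prod_type_right]; rfl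
  by_cases h : i = i' <;> by_cases h' : o = o' <;>
    simp [floorOut, floorIn, ptrOut, ptrIn, h, h', this, ← Finset.mul_sum,
      mul_assoc]

theorem floorOut_floorIn_one (hd : 1 ≤ d) : floorOut (floorIn (1 : PairMat d)) = 1 := by
  have : (d : ℂ) ≠ 0 := by exact_mod_cast (by omega : d ≠ 0)
  rw [floorOut_floorIn]
  simp [Matrix.trace_one]
  field_simp
  simp

theorem ptrOut_smul_one (hd : 1 ≤ d) : ptrOut ((d : ℂ)⁻¹ • (1 : PairMat d)) = 1 := by
  have : (d : ℂ) ≠ 0 := by exact_mod_cast (by omega : d ≠ 0)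
  ext i i'
  by_cases h : i = i' <;> simp [ptrOut, Matrix.one_apply, h, this]

theorem ptrIn_smul_one (hd : 1 ≤ d) : ptrIn ((d : ℂ)⁻¹ • (1 : PairMat d)) = 1 := by
  have : (d : ℂ) ≠ 0 := by exact_mod_cast (by omega : d ≠ 0)
  ext i i'
  by_cases h : i = i' <;> simp [ptrIn, Matrix.one_apply, h, this]

theorem isBistochasticChoi_smul_one (hd : 1 ≤ d) :
    IsBistochasticChoi ((d : ℂ)⁻¹ • (1 : PairMat d)) :=
  ⟨Matrix.PosSemidef.one.smul (by simp), ptrOut_smul_one hd, ptrIn_smul_one hd⟩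

theorem IsBistochasticChoi.sub_mem_marginalFree (hd : 1 ≤ d) {N : PairMat d}
    (hN : IsBistochasticChoi N) : N - (d : ℂ)⁻¹ • (1 : PairMat d) ∈ marginalFree d := by
  constructor
  · rw [ptrOut_sub, hN.2.1, ptrOut_smul_one hd, sub_self]
  · rw [ptrIn_sub, hN.2.2, ptrIn_smul_one hd, sub_self]

open scoped MatrixOrder Matrix.Norms.L2Operator in
theorem exists_pos_smul_one_add_posSemidef {n : Type*} [Fintype n] [DecidableEq n]
    {X : Matrix n n ℂ} (hX : X.IsHermitian) :
    ∃ r : ℝ, 0 < r ∧ ((r : ℂ) • (1 : Matrix n n ℂ) + X).PosSemidef := by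
  refine ⟨‖X‖ + 1, by positivity, ?_⟩
  have h : -(algebraMap ℝ (Matrix n n ℂ) ‖X‖) ≤ X :=
    IsSelfAdjoint.neg_algebraMap_norm_le_self hX.isSelfAdjoint
  have h' : (‖X‖ • (1 : Matrix n n ℂ) + X).PosSemidef := by
    rw [Matrix.le_iff, Algebra.algebraMap_eq_smul_one] at h
    simpa [add_comm] using h
  have e : ((‖X‖ + 1 : ℝ) : ℂ) • (1 : Matrix n n ℂ) + X = 1 + (‖X‖ • (1 : Matrix n n ℂ) + X) := by
    rw [Complex.coe_smul, add_smul, one_smul]; abel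
  rw [e]
  exact Matrix.PosSemidef.one.add h'

/-- A linear map that is constant on bistochastic Choi operators kills every operator with
vanishing partial traces. -/
theorem map_marginalFree_eq_zero {E : Type*} [AddCommGroup E] [Module ℂ E] (hd : 1 ≤ d)
    (G : (PairMat d) →ₗ[ℂ] E) (c : E) (hG : ∀ N, IsBistochasticChoi N → G N = c)
    {X : PairMat d} (hX : X ∈ marginalFree d) : G X = 0 := by
  have hd0 : (d : ℂ) ≠ 0 := by exact_mod_cast (by omega : d ≠ 0)
  have herm {X : PairMat d} (hX : X ∈ marginalFree d) (hH : X.IsHermitian) : G X = 0 := by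
    obtain ⟨r, hr, hpos⟩ := exists_pos_smul_one_add_posSemidef hH
    have hr0 : (r : ℂ) ≠ 0 := by exact_mod_cast hr.ne'
    have hmem : ((d : ℂ) * r)⁻¹ • X ∈ marginalFree d := Submodule.smul_mem _ _ hX
    have hN : IsBistochasticChoi ((d : ℂ)⁻¹ • (1 : PairMat d) + ((d : ℂ) * r)⁻¹ • X) := by
      refine ⟨?_, ?_, ?_⟩
      · have hc : (0 : ℂ) ≤ ((d : ℂ) * r)⁻¹ := by
          rw [show ((d : ℂ) * r)⁻¹ = ((((d : ℝ) * r)⁻¹ : ℝ) : ℂ) by push_cast; rfl]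
          exact Complex.zero_le_real.mpr (by positivity)
        convert hpos.smul hc using 1
        rw [smul_add, smul_smul]
        congr 2
        field_simp
      · rw [ptrOut_add, ptrOut_smul_one hd, hmem.1, add_zero]
      · rw [ptrIn_add, ptrIn_smul_one hd, hmem.2, add_zero]
    have h := hG _ hN
    rw [map_add, hG _ (isBistochasticChoi_smul_one hd), map_smul, add_eq_left] at h
    exact (smul_eq_zero.mp h).resolve_left (inv_ne_zero (mul_ne_zero hd0 hr0))
  have hXH := conjTranspose_mem_marginalFree hX
  have h₁ : G (X + Xᴴ) = 0 := herm (Submodule.add_mem _ hX hXH) (by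
    rw [Matrix.IsHermitian, conjTranspose_add, conjTranspose_conjTranspose, add_comm])
  have h₂ : G (Complex.I • (X - Xᴴ)) = 0 :=
    herm (Submodule.smul_mem _ _ (Submodule.sub_mem _ hX hXH)) (by
      rw [Matrix.IsHermitian, conjTranspose_smul, conjTranspose_sub, conjTranspose_conjTranspose]
      simp [← smul_neg])
  rw [map_smul] at h₂
  have h₃ := (smul_eq_zero.mp h₂).resolve_left Complex.I_ne_zero
  have h₄ : (2 : ℂ) • G X = 0 := by
    rw [← map_smul, show (2 : ℂ) • X = (X + Xᴴ) + (X - Xᴴ) by rw [two_smul]; abel,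
      map_add, h₁, h₃, add_zero]
  exact (smul_eq_zero.mp h₄).resolve_left two_ne_zero

/-- The bilinear pairing `(R, X) ↦ Tr (R Xᵀ)`. -/
noncomputable def pairing (R X : PairMat d) : ℂ := ∑ p, ∑ q, R p q * X p q

theorem pairing_comm (R X : PairMat d) : pairing R X = pairing X R := by
  simp only [pairing, mul_comm]

theorem pairing_floorIn_eq (R X : PairMat d) :
    pairing (floorIn R) X = ∑ o, ∑ o', (d : ℂ)⁻¹ * (ptrIn R o o' * ptrIn X o o') := by
  have h (i o : Fin d) : ∑ i', ∑ o', (if i = i' then (d : ℂ)⁻¹ else 0) * ptrIn R o o' *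
      X (i, o) (i', o') = ∑ o', (d : ℂ)⁻¹ * (ptrIn R o o' * X (i, o) (i, o')) := by
    rw [Finset.sum_comm]
    simp [mul_assoc]
  simp only [pairing, floorIn, Fintype.sum_prod_type, of_apply, h]
  rw [Finset.sum_comm]
  refine Finset.sum_congr rfl fun o _ => ?_
  rw [Finset.sum_comm]
  simp only [← Finset.mul_sum]
  rfl

theorem pairing_floorOut_eq (R X : PairMat d) :
    pairing (floorOut R) X = ∑ i, ∑ i', (d : ℂ)⁻¹ * (ptrOut R i i' * ptrOut X i i') := by
  have h (i o i' : Fin d) : ∑ o', (if o = o' then (d : ℂ)⁻¹ else 0) * ptrOut R i i' *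
      X (i, o) (i', o') = (d : ℂ)⁻¹ * (ptrOut R i i' * X (i, o) (i', o)) := by
    simp [mul_assoc]
  simp only [pairing, floorOut, Fintype.sum_prod_type, of_apply, h]
  refine Finset.sum_congr rfl fun i _ => ?_
  rw [Finset.sum_comm]
  simp only [← Finset.mul_sum]
  rfl

theorem pairing_floorIn (R X : PairMat d) : pairing (floorIn R) X = pairing R (floorIn X) := by
  rw [pairing_comm R, pairing_floorIn_eq, pairing_floorIn_eq]
  simp only [mul_comm (ptrIn R _ _)]

theorem pairing_floorOut (R X : PairMat d) : pairing (floorOut R) X = pairing R (floorOut X) := by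
  rw [pairing_comm R, pairing_floorOut_eq, pairing_floorOut_eq]
  simp only [mul_comm (ptrOut R _ _)]

end Pair

section Form

variable {dA dB dCI dCO}

theorem trToCI_add (M M' : Mat6 dA dB dCI dCO) :
    trToCI dA dB dCI dCO (M + M') = trToCI dA dB dCI dCO M + trToCI dA dB dCI dCO M' := by
  ext; simp [trToCI, Finset.sum_add_distrib]

theorem trToCI_smul (c : ℂ) (M : Mat6 dA dB dCI dCO) :
    trToCI dA dB dCI dCO (c • M) = c • trToCI dA dB dCI dCO M := by
  ext; simp [trToCI, Finset.mul_sum]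

/-- The bilinear map `(X, Y) ↦ Tr_{A_I A_O B_I B_O C_O}[M (X ⊗ Y ⊗ I)ᵀ]`. -/
noncomputable def supermapForm (M : Mat6 dA dB dCI dCO) :
    (PairMat dA) →ₗ[ℂ] (PairMat dB) →ₗ[ℂ] Matrix (Fin dCI) (Fin dCI) ℂ :=
  LinearMap.mk₂ ℂ (fun X Y => trToCI dA dB dCI dCO (M * (embed dA dB dCI dCO X Y)ᵀ))
    (fun X X' Y => by
      rw [← trToCI_add, ← Matrix.mul_add, ← transpose_add]
      congr; ext; simp only [embed, of_apply, Matrix.add_apply]; ring)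
    (fun c X Y => by
      rw [← trToCI_smul, ← Matrix.mul_smul, ← transpose_smul]
      congr; ext; simp only [embed, of_apply, Matrix.smul_apply, smul_eq_mul]; ring)
    (fun X Y Y' => by
      rw [← trToCI_add, ← Matrix.mul_add, ← transpose_add]
      congr; ext; simp only [embed, of_apply, Matrix.add_apply]; ring)
    (fun c X Y => by
      rw [← trToCI_smul, ← Matrix.mul_smul, ← transpose_smul]
      congr; ext; simp only [embed, of_apply, Matrix.smul_apply, smul_eq_mul]; ring)

/-- Contraction of the `B` and `C_O` factors of `M` against `Y`. -/
noncomputable def contractB (M : Mat6 dA dB dCI dCO) (Y : PairMat dB) (c c' : Fin dCI) :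
    PairMat dA :=
  Matrix.of fun p p' => ∑ z : ((Fin dB × Fin dB) × (Fin dB × Fin dB)) × Fin dCO,
    M (p.1, p.2, z.1.1.1, z.1.1.2, c, z.2) (p'.1, p'.2, z.1.2.1, z.1.2.2, c', z.2) *
      Y z.1.1 z.1.2

/-- Contraction of the `A` and `C_O` factors of `M` against `X`. -/
noncomputable def contractA (M : Mat6 dA dB dCI dCO) (X : PairMat dA) (c c' : Fin dCI) :
    PairMat dB :=
  Matrix.of fun q q' => ∑ z : ((Fin dA × Fin dA) × (Fin dA × Fin dA)) × Fin dCO,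
    M (z.1.1.1, z.1.1.2, q.1, q.2, c, z.2) (z.1.2.1, z.1.2.2, q'.1, q'.2, c', z.2) *
      X z.1.1 z.1.2

theorem supermapForm_apply (M : Mat6 dA dB dCI dCO) (X : PairMat dA) (Y : PairMat dB)
    (c c' : Fin dCI) :
    supermapForm M X Y c c' = ∑ p : Fin dA × Fin dA, ∑ q : Fin dB × Fin dB, ∑ co,
      ∑ p' : Fin dA × Fin dA, ∑ q' : Fin dB × Fin dB,
        M (p.1, p.2, q.1, q.2, c, co) (p'.1, p'.2, q'.1, q'.2, c', co) * (X p p' * Y q q') := by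
  change trToCI dA dB dCI dCO (M * (embed dA dB dCI dCO X Y)ᵀ) c c' = _
  simp only [trToCI, of_apply, Fintype.sum_prod_type (α₁ := Fin dA),
    Fintype.sum_prod_type (α₁ := Fin dB)]
  refine Finset.sum_congr rfl fun ai _ => Finset.sum_congr rfl fun ao _ =>
    Finset.sum_congr rfl fun bi _ => Finset.sum_congr rfl fun bo _ =>
    Finset.sum_congr rfl fun co _ => ?_
  simp only [Matrix.mul_apply, Fintype.sum_prod_type]
  refine Finset.sum_congr rfl fun ai' _ => Finset.sum_congr rfl fun ao' _ =>
    Finset.sum_congr rfl fun bi' _ => Finset.sum_congr rfl fun bo' _ => ?_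
  simp only [embed, transpose_apply, of_apply, mul_ite, mul_one, mul_zero, Finset.sum_ite_eq,
    Finset.mem_univ, if_true]

theorem sum_reorder {P Q O : Type*} [Fintype P] [Fintype Q] [Fintype O]
    (g : P → Q → O → P → Q → ℂ) :
    ∑ p, ∑ q, ∑ o, ∑ p', ∑ q', g p q o p' q' =
      ∑ p, ∑ p', ∑ z : (Q × Q) × O, g p z.1.1 z.2 p' z.1.2 := by
  refine Finset.sum_congr rfl fun p _ => ?_
  simp only [Fintype.sum_prod_type]
  calc
    _ = ∑ q, ∑ p', ∑ o, ∑ q', g p q o p' q' :=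
      Finset.sum_congr rfl fun q _ => Finset.sum_comm
    _ = ∑ p', ∑ q, ∑ o, ∑ q', g p q o p' q' := Finset.sum_comm
    _ = _ := Finset.sum_congr rfl fun p' _ => Finset.sum_congr rfl fun q _ => Finset.sum_comm

theorem supermapForm_eq_pairing_contractB (M : Mat6 dA dB dCI dCO) (X : PairMat dA)
    (Y : PairMat dB) (c c' : Fin dCI) :
    supermapForm M X Y c c' = pairing (contractB M Y c c') X := by
  rw [supermapForm_apply, sum_reorder]
  simp only [pairing, contractB, of_apply, Finset.sum_mul, mul_assoc, mul_comm (X _ _)]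

theorem supermapForm_eq_pairing_contractA (M : Mat6 dA dB dCI dCO) (X : PairMat dA)
    (Y : PairMat dB) (c c' : Fin dCI) :
    supermapForm M X Y c c' = pairing (contractA M X c c') Y := by
  rw [supermapForm_apply, Finset.sum_comm]
  conv_lhs => enter [2, q, 2, p, 2, co]; rw [Finset.sum_comm]
  rw [sum_reorder]
  simp only [pairing, contractA, of_apply, Finset.sum_mul, mul_assoc]

theorem supermapForm_floorAI (M : Mat6 dA dB dCI dCO) (X : PairMat dA) (Y : PairMat dB) :
    supermapForm (floorAI dA dB dCI dCO M) X Y = supermapForm M (floorIn X) Y := by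
  ext c c'
  rw [supermapForm_eq_pairing_contractB, supermapForm_eq_pairing_contractB, ← pairing_floorIn]
  congr 1
  ext p p'
  simp only [contractB, floorAI, floorIn, ptrIn, of_apply, mul_assoc, Finset.sum_mul]
  rw [Finset.sum_comm]
  simp only [Finset.mul_sum]

theorem supermapForm_floorAO (M : Mat6 dA dB dCI dCO) (X : PairMat dA) (Y : PairMat dB) :
    supermapForm (floorAO dA dB dCI dCO M) X Y = supermapForm M (floorOut X) Y := by
  ext c c'
  rw [supermapForm_eq_pairing_contractB, supermapForm_eq_pairing_contractB, ← pairing_floorOut]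
  congr 1
  ext p p'
  simp only [contractB, floorAO, floorOut, ptrOut, of_apply, mul_assoc, Finset.sum_mul]
  rw [Finset.sum_comm]
  simp only [Finset.mul_sum]

theorem supermapForm_floorBI (M : Mat6 dA dB dCI dCO) (X : PairMat dA) (Y : PairMat dB) :
    supermapForm (floorBI dA dB dCI dCO M) X Y = supermapForm M X (floorIn Y) := by
  ext c c'
  rw [supermapForm_eq_pairing_contractA, supermapForm_eq_pairing_contractA, ← pairing_floorIn]
  congr 1
  ext p p'
  simp only [contractA, floorBI, floorIn, ptrIn, of_apply, mul_assoc, Finset.sum_mul]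
  rw [Finset.sum_comm]
  simp only [Finset.mul_sum]

theorem supermapForm_floorBO (M : Mat6 dA dB dCI dCO) (X : PairMat dA) (Y : PairMat dB) :
    supermapForm (floorBO dA dB dCI dCO M) X Y = supermapForm M X (floorOut Y) := by
  ext c c'
  rw [supermapForm_eq_pairing_contractA, supermapForm_eq_pairing_contractA, ← pairing_floorOut]
  congr 1
  ext p p'
  simp only [contractA, floorBO, floorOut, ptrOut, of_apply, mul_assoc, Finset.sum_mul]
  rw [Finset.sum_comm]
  simp only [Finset.mul_sum]

theorem supermapForm_sub (M M' : Mat6 dA dB dCI dCO) :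
    supermapForm (M - M') = supermapForm M - supermapForm M' := by
  ext X Y c c'
  simp [supermapForm_apply, sub_mul, Finset.sum_sub_distrib]

theorem supermapForm_deltaA (M : Mat6 dA dB dCI dCO) (X : PairMat dA) (Y : PairMat dB) :
    supermapForm (deltaAI dA dB dCI dCO (deltaAO dA dB dCI dCO M)) X Y =
      supermapForm M (deltaPair X) Y := by
  rw [deltaAI, supermapForm_sub, LinearMap.sub_apply, LinearMap.sub_apply, supermapForm_floorAI,
    ← LinearMap.sub_apply, ← map_sub, deltaAO, supermapForm_sub, LinearMap.sub_apply,
    LinearMap.sub_apply, supermapForm_floorAO, ← LinearMap.sub_apply, ← map_sub, deltaPair]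

theorem supermapForm_deltaB (M : Mat6 dA dB dCI dCO) (X : PairMat dA) (Y : PairMat dB) :
    supermapForm (deltaBI dA dB dCI dCO (deltaBO dA dB dCI dCO M)) X Y =
      supermapForm M X (deltaPair Y) := by
  rw [deltaBI, supermapForm_sub, LinearMap.sub_apply, LinearMap.sub_apply, supermapForm_floorBI,
    ← map_sub, deltaBO, supermapForm_sub, LinearMap.sub_apply, LinearMap.sub_apply,
    supermapForm_floorBO, ← map_sub, deltaPair]

theorem supermapForm_one_one (M : Mat6 dA dB dCI dCO) :
    supermapForm M 1 1 = trToCI dA dB dCI dCO M := by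
  have h : embed dA dB dCI dCO 1 1 = 1 := by
    ext p q
    simp only [embed, of_apply, Matrix.one_apply, Prod.ext_iff, ite_and, mul_ite, mul_one,
      mul_zero]
    split_ifs <;> rfl
  simp [supermapForm, h]

theorem sum_eq_zero_of_floorCO_eq_zero {M : Mat6 dA dB dCI dCO}
    (h : floorCO dA dB dCI dCO M = 0) (ai ao bi bo ci ai' ao' bi' bo' ci') :
    ∑ co, M (ai, ao, bi, bo, ci, co) (ai', ao', bi', bo', ci', co) = 0 := by
  rcases isEmpty_or_nonempty (Fin dCO) with _ | ⟨⟨co⟩⟩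
  · simp
  · have := congrFun (congrFun h (ai, ao, bi, bo, ci, co)) (ai', ao', bi', bo', ci', co)
    have hd : (dCO : ℂ) ≠ 0 := by exact_mod_cast co.pos.ne'
    simpa [floorCO, hd] using this

theorem supermapForm_single (M : Mat6 dA dB dCI dCO) (p p' : Fin dA × Fin dA)
    (q q' : Fin dB × Fin dB) (c c' : Fin dCI) :
    supermapForm M (Matrix.single p p' 1) (Matrix.single q q' 1) c c' =
      ∑ co, M (p.1, p.2, q.1, q.2, c, co) (p'.1, p'.2, q'.1, q'.2, c', co) := by
  rw [supermapForm_apply, Fintype.sum_eq_single p, Fintype.sum_eq_single q]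
  · refine Finset.sum_congr rfl fun co _ => ?_
    rw [Fintype.sum_eq_single p', Fintype.sum_eq_single q']
    · simp
    · intro x hx
      simp [hx.symm]
    · intro x hx
      simp [Matrix.single_apply, hx.symm]
  · intro x hx
    simp [Matrix.single_apply, hx.symm]
  · intro x hx
    simp [Matrix.single_apply, hx.symm]

theorem floorCO_eq_zero_iff (M : Mat6 dA dB dCI dCO) :
    floorCO dA dB dCI dCO M = 0 ↔ ∀ X Y, supermapForm M X Y = 0 := by
  constructor
  · intro h X Y
    ext c c'
    rw [supermapForm_eq_pairing_contractB, pairing, Matrix.zero_apply]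
    refine Finset.sum_eq_zero fun p _ => Finset.sum_eq_zero fun p' _ => ?_
    rw [contractB, of_apply, Fintype.sum_prod_type]
    simp only [← Finset.sum_mul, sum_eq_zero_of_floorCO_eq_zero h, zero_mul,
      Finset.sum_const_zero]
  · intro h
    ext p q
    have := congrFun (congrFun (h (Matrix.single (p.1, p.2.1) (q.1, q.2.1) 1)
      (Matrix.single (p.2.2.1, p.2.2.2.1) (q.2.2.1, q.2.2.2.1) 1)) p.2.2.2.2.1) q.2.2.2.2.1
    rw [supermapForm_single] at this
    simp only [floorCO, of_apply, this, Matrix.zero_apply, mul_zero]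

theorem floorBI_floorBO_floorCO (M : Mat6 dA dB dCI dCO) :
    floorBI dA dB dCI dCO (floorBO dA dB dCI dCO (floorCO dA dB dCI dCO M)) =
      floorCO dA dB dCI dCO (floorBI dA dB dCI dCO (floorBO dA dB dCI dCO M)) := by
  ext p q
  simp only [floorBI, floorBO, floorCO, of_apply, Finset.mul_sum]
  conv_lhs => enter [2, x]; rw [Finset.sum_comm]
  rw [Finset.sum_comm]
  refine Finset.sum_congr rfl fun _ _ => Finset.sum_congr rfl fun _ _ =>
    Finset.sum_congr rfl fun _ _ => by ring

theorem floorAI_floorAO_floorCO (M : Mat6 dA dB dCI dCO) :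
    floorAI dA dB dCI dCO (floorAO dA dB dCI dCO (floorCO dA dB dCI dCO M)) =
      floorCO dA dB dCI dCO (floorAI dA dB dCI dCO (floorAO dA dB dCI dCO M)) := by
  ext p q
  simp only [floorAI, floorAO, floorCO, of_apply, Finset.mul_sum]
  conv_lhs => enter [2, x]; rw [Finset.sum_comm]
  rw [Finset.sum_comm]
  refine Finset.sum_congr rfl fun _ _ => Finset.sum_congr rfl fun _ _ =>
    Finset.sum_congr rfl fun _ _ => by ring

end Form


/-- **Characterization of bipartite supermaps on no-signaling bistochastic channels.**
For a Hermitian operator `S` on `H_{A_I}⊗H_{A_O}⊗H_{B_I}⊗H_{B_O}⊗H_{C_I}⊗H_{C_O}`,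
the following are equivalent:
(i) for all Choi operators `N₁`, `N₂` of bistochastic channels on `(A_I, A_O)` and
`(B_I, B_O)`, `Tr_{A_I A_O B_I B_O C_O}[S·(N₁ ⊗ N₂ ⊗ I_{C_I C_O})ᵀ] = I_{C_I}`;
(ii) `Tr_{A_I A_O B_I B_O C_O}(S) = d_A·d_B·I_{C_I}`,
`⌊Δ_{A_I}Δ_{A_O}(S)⌋_{B_I B_O C_O} = 0`, `⌊Δ_{B_I}Δ_{B_O}(S)⌋_{A_I A_O C_O} = 0`, and
`⌊Δ_{A_I}Δ_{A_O}Δ_{B_I}Δ_{B_O}(S)⌋_{C_O} = 0`. -/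
theorem bipartite_supermap_characterization
    (hdA : 1 ≤ dA) (hdB : 1 ≤ dB)
    (S : Mat6 dA dB dCI dCO) (hS : S.IsHermitian) :
    (∀ (N₁ : Matrix (Fin dA × Fin dA) (Fin dA × Fin dA) ℂ)
       (N₂ : Matrix (Fin dB × Fin dB) (Fin dB × Fin dB) ℂ),
       IsBistochasticChoi N₁ → IsBistochasticChoi N₂ →
       trToCI dA dB dCI dCO (S * (embed dA dB dCI dCO N₁ N₂)ᵀ) = 1) ↔
    (trToCI dA dB dCI dCO S = ((dA : ℂ) * (dB : ℂ)) • 1 ∧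
     floorBI dA dB dCI dCO (floorBO dA dB dCI dCO (floorCO dA dB dCI dCO
       (deltaAI dA dB dCI dCO (deltaAO dA dB dCI dCO S)))) = 0 ∧
     floorAI dA dB dCI dCO (floorAO dA dB dCI dCO (floorCO dA dB dCI dCO
       (deltaBI dA dB dCI dCO (deltaBO dA dB dCI dCO S)))) = 0 ∧
     floorCO dA dB dCI dCO (deltaAI dA dB dCI dCO (deltaAO dA dB dCI dCO
       (deltaBI dA dB dCI dCO (deltaBO dA dB dCI dCO S)))) = 0) := by
  have hA0 : (dA : ℂ) ≠ 0 := by exact_mod_cast (by omega : dA ≠ 0)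
  have hB0 : (dB : ℂ) ≠ 0 := by exact_mod_cast (by omega : dB ≠ 0)
  have hchan : ∀ N₁ N₂, trToCI dA dB dCI dCO (S * (embed dA dB dCI dCO N₁ N₂)ᵀ) =
      supermapForm S N₁ N₂ := fun _ _ => rfl
  simp only [hchan, floorBI_floorBO_floorCO, floorAI_floorAO_floorCO, floorCO_eq_zero_iff,
    supermapForm_floorAI, supermapForm_floorAO, supermapForm_floorBI, supermapForm_floorBO,
    supermapForm_deltaA, supermapForm_deltaB, ← supermapForm_one_one]
  have hone : supermapForm S ((dA : ℂ)⁻¹ • 1) ((dB : ℂ)⁻¹ • 1) =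
      ((dA : ℂ) * (dB : ℂ))⁻¹ • supermapForm S 1 1 := by
    rw [map_smul, map_smul, LinearMap.smul_apply, smul_smul, mul_inv, mul_comm]
  have hAB0 := mul_ne_zero hA0 hB0
  constructor
  · intro h
    have uA := isBistochasticChoi_smul_one hdA
    have uB := isBistochasticChoi_smul_one hdB
    have hX {X} (hX : X ∈ marginalFree dA) {N₂} (hN₂ : IsBistochasticChoi N₂) :
        supermapForm S X N₂ = 0 :=
      map_marginalFree_eq_zero hdA ((supermapForm S).flip N₂) 1 (fun N₁ hN₁ => h N₁ N₂ hN₁ hN₂) hX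
    have hY {Y} (hY : Y ∈ marginalFree dB) {N₁} (hN₁ : IsBistochasticChoi N₁) :
        supermapForm S N₁ Y = 0 :=
      map_marginalFree_eq_zero hdB (supermapForm S N₁) 1 (fun N₂ hN₂ => h N₁ N₂ hN₁ hN₂) hY
    have hX1 {X} (hX' : X ∈ marginalFree dA) : supermapForm S X 1 = 0 := by
      have := hX hX' uB
      rw [map_smul] at this
      exact (smul_eq_zero.mp this).resolve_left (inv_ne_zero hB0)
    have h1Y {Y} (hY' : Y ∈ marginalFree dB) : supermapForm S 1 Y = 0 := by
      have := hY hY' uA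
      rw [map_smul, LinearMap.smul_apply] at this
      exact (smul_eq_zero.mp this).resolve_left (inv_ne_zero hA0)
    refine ⟨?_, fun X Y => ?_, fun X Y => ?_, fun X Y => ?_⟩
    · rw [← h _ _ uA uB, hone, smul_smul, mul_inv_cancel₀ hAB0, one_smul]
    · rw [floorOut_floorIn, map_smul, hX1 (deltaPair_mem_marginalFree hdA X), smul_zero]
    · rw [floorOut_floorIn, map_smul, LinearMap.smul_apply,
        h1Y (deltaPair_mem_marginalFree hdB Y), smul_zero]
    · exact map_marginalFree_eq_zero hdB (supermapForm S (deltaPair X)) 0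
        (fun N₂ hN₂ => hX (deltaPair_mem_marginalFree hdA X) hN₂)
        (deltaPair_mem_marginalFree hdB Y)
  · rintro ⟨h₁, h₂, h₃, h₄⟩ N₁ N₂ hN₁ hN₂
    have kA := hN₁.sub_mem_marginalFree hdA
    have kB := hN₂.sub_mem_marginalFree hdB
    have e₂ := h₂ (N₁ - (dA : ℂ)⁻¹ • 1) 1
    have e₃ := h₃ 1 (N₂ - (dB : ℂ)⁻¹ • 1)
    have e₄ := h₄ (N₁ - (dA : ℂ)⁻¹ • 1) (N₂ - (dB : ℂ)⁻¹ • 1)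
    rw [deltaPair_eq_self kA, floorOut_floorIn_one hdB] at e₂
    rw [deltaPair_eq_self kB, floorOut_floorIn_one hdA] at e₃
    rw [deltaPair_eq_self kA, deltaPair_eq_self kB] at e₄
    rw [h₁, smul_smul, inv_mul_cancel₀ hAB0, one_smul] at hone
    rw [← sub_add_cancel N₁ ((dA : ℂ)⁻¹ • 1), ← sub_add_cancel N₂ ((dB : ℂ)⁻¹ • 1)]
    rw [map_add (supermapForm S), LinearMap.add_apply, map_add, map_add, e₄, hone, map_smul, e₂,
      map_smul, LinearMap.smul_apply, e₃]
    simp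

end BipartiteSupermap
end

section
/- Let M be a complex matrix on a bipartite index set H₁ ⊗ H₂ (i.e., a matrix indexed by pairs). Then the partial traces of M over both factors vanish, Tr₁(M) = 0 and Tr₂(M) = 0, if and only if M lies in the linear span of the set of Kronecker products {A ⊗ B : A a matrix on H₁ with Tr(A) = 0, B a matrix on H₂ with Tr(B) = 0}. -/
open Matrix
open scoped Kronecker

/-- Partial trace over the first factor of a matrix on a bipartite index set. -/
noncomputable def ptrFst {ι₁ ι₂ : Type*} [Fintype ι₁]
    (M : Matrix (ι₁ × ι₂) (ι₁ × ι₂) ℂ) : Matrix ι₂ ι₂ ℂ :=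
  Matrix.of fun j j' => ∑ i : ι₁, M (i, j) (i, j')

/-- Partial trace over the second factor of a matrix on a bipartite index set. -/
noncomputable def ptrSnd {ι₁ ι₂ : Type*} [Fintype ι₂]
    (M : Matrix (ι₁ × ι₂) (ι₁ × ι₂) ℂ) : Matrix ι₁ ι₁ ℂ :=
  Matrix.of fun i i' => ∑ j : ι₂, M (i, j) (i', j)

theorem ptrFst_add {ι₁ ι₂ : Type*} [Fintype ι₁] (M N : Matrix (ι₁ × ι₂) (ι₁ × ι₂) ℂ) :
    ptrFst (M + N) = ptrFst M + ptrFst N := by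
  ext j j'
  simp [ptrFst, Finset.sum_add_distrib]

theorem ptrFst_smul {ι₁ ι₂ : Type*} [Fintype ι₁] (c : ℂ)
    (M : Matrix (ι₁ × ι₂) (ι₁ × ι₂) ℂ) : ptrFst (c • M) = c • ptrFst M := by
  ext j j'
  simp [ptrFst, Finset.mul_sum]

theorem ptrFst_zero {ι₁ ι₂ : Type*} [Fintype ι₁] :
    ptrFst (0 : Matrix (ι₁ × ι₂) (ι₁ × ι₂) ℂ) = 0 := by
  ext j j'
  simp [ptrFst]

theorem ptrFst_kronecker {ι₁ ι₂ : Type*} [Fintype ι₁] (A : Matrix ι₁ ι₁ ℂ)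
    (B : Matrix ι₂ ι₂ ℂ) : ptrFst (A ⊗ₖ B) = A.trace • B := by
  ext j j'
  simp [ptrFst, Matrix.trace, Finset.sum_mul]

theorem ptrSnd_add {ι₁ ι₂ : Type*} [Fintype ι₂] (M N : Matrix (ι₁ × ι₂) (ι₁ × ι₂) ℂ) :
    ptrSnd (M + N) = ptrSnd M + ptrSnd N := by
  ext i i'
  simp [ptrSnd, Finset.sum_add_distrib]

theorem ptrSnd_smul {ι₁ ι₂ : Type*} [Fintype ι₂] (c : ℂ)
    (M : Matrix (ι₁ × ι₂) (ι₁ × ι₂) ℂ) : ptrSnd (c • M) = c • ptrSnd M := by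
  ext i i'
  simp [ptrSnd, Finset.mul_sum]

theorem ptrSnd_zero {ι₁ ι₂ : Type*} [Fintype ι₂] :
    ptrSnd (0 : Matrix (ι₁ × ι₂) (ι₁ × ι₂) ℂ) = 0 := by
  ext i i'
  simp [ptrSnd]

theorem ptrSnd_kronecker {ι₁ ι₂ : Type*} [Fintype ι₂] (A : Matrix ι₁ ι₁ ℂ)
    (B : Matrix ι₂ ι₂ ℂ) : ptrSnd (A ⊗ₖ B) = B.trace • A := by
  ext i i'
  simp [ptrSnd, Matrix.trace, Finset.mul_sum, mul_comm]

/-- Subtracting the parts of `M` carried by the partial traces, relative to reference matrices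
`E` and `F` of trace one, lands in the span of Kronecker products of traceless matrices. -/
theorem sub_ptr_mem_span {ι₁ ι₂ : Type*} [Fintype ι₁] [Fintype ι₂]
    {E : Matrix ι₁ ι₁ ℂ} {F : Matrix ι₂ ι₂ ℂ} (hE : E.trace = 1) (hF : F.trace = 1)
    (M : Matrix (ι₁ × ι₂) (ι₁ × ι₂) ℂ) :
    M - E ⊗ₖ ptrFst M - ptrSnd M ⊗ₖ F + (ptrFst M).trace • (E ⊗ₖ F) ∈
      Submodule.span ℂ {K : Matrix (ι₁ × ι₂) (ι₁ × ι₂) ℂ |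
        ∃ (A : Matrix ι₁ ι₁ ℂ) (B : Matrix ι₂ ι₂ ℂ),
          A.trace = 0 ∧ B.trace = 0 ∧ K = A ⊗ₖ B} := by
  classical
  induction M using Matrix.induction_on' with
  | h_zero => simp [ptrFst_zero, ptrSnd_zero]
  | h_add M N hM hN =>
    convert add_mem hM hN using 1
    rw [ptrFst_add, ptrSnd_add, kronecker_add, add_kronecker, trace_add, add_smul]
    abel
  | h_std_basis p q c =>
    obtain ⟨a, b⟩ := p
    obtain ⟨a', b'⟩ := q
    have hs : single (a, b) (a', b') c = single a a' c ⊗ₖ single b b' (1 : ℂ) := by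
      rw [single_kronecker_single, mul_one]
    rw [hs]
    generalize single a a' c = A
    generalize single b b' (1 : ℂ) = B
    refine Submodule.subset_span ⟨A - A.trace • E, B - B.trace • F, ?_, ?_, ?_⟩
    · simp [hE]
    · simp [hF]
    · rw [ptrFst_kronecker, ptrSnd_kronecker]
      ext ⟨i, j⟩ ⟨i', j'⟩
      simp
      ring

/-- A matrix `M` on a bipartite index set has vanishing partial traces over both
factors if and only if it lies in the linear span of Kronecker products of
traceless matrices. -/
theorem traceless_tensor_span {ι₁ ι₂ : Type*} [Fintype ι₁] [Fintype ι₂]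
    (M : Matrix (ι₁ × ι₂) (ι₁ × ι₂) ℂ) :
    (ptrFst M = 0 ∧ ptrSnd M = 0) ↔
    M ∈ Submodule.span ℂ {K : Matrix (ι₁ × ι₂) (ι₁ × ι₂) ℂ |
      ∃ (A : Matrix ι₁ ι₁ ℂ) (B : Matrix ι₂ ι₂ ℂ),
        A.trace = 0 ∧ B.trace = 0 ∧ K = A ⊗ₖ B} := by
  classical
  constructor
  · rintro ⟨h₁, h₂⟩
    rcases isEmpty_or_nonempty (ι₁ × ι₂) with _ | ⟨i, j⟩
    · rw [Subsingleton.elim M 0]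
      exact zero_mem _
    · simpa [h₁, h₂] using sub_ptr_mem_span (trace_single_eq_same i (1 : ℂ))
        (trace_single_eq_same j (1 : ℂ)) M
  · intro h
    induction h using Submodule.span_induction with
    | mem K hK =>
      obtain ⟨A, B, hA, hB, rfl⟩ := hK
      simp [ptrFst_kronecker, ptrSnd_kronecker, hA, hB]
    | zero => exact ⟨ptrFst_zero, ptrSnd_zero⟩
    | add M N _ _ hM hN => simp [ptrFst_add, ptrSnd_add, hM, hN]
    | smul c M _ hM => simp [ptrFst_smul, ptrSnd_smul, hM]
end

section
/- Let N be a complex matrix on H_in ⊗ H_out where both factors have dimension d ≥ 1. Then N satisfies Tr_out(N) = I_in and Tr_in(N) = I_out (the defining partial-trace conditions of the Choi operator of a bistochastic channel) if and only if N = (1/d)·(I_in ⊗ I_out) + M for some matrix M in the linear span of {A ⊗ B : Tr(A) = 0, Tr(B) = 0}. -/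
open Matrix
open scoped Kronecker

/-- Partial trace over the output (second) factor. -/
noncomputable def ptrOut {d : ℕ} (N : Matrix (Fin d × Fin d) (Fin d × Fin d) ℂ) :
    Matrix (Fin d) (Fin d) ℂ :=
  Matrix.of fun i i' => ∑ o : Fin d, N (i, o) (i', o)

/-- Partial trace over the input (first) factor. -/
noncomputable def ptrIn {d : ℕ} (N : Matrix (Fin d × Fin d) (Fin d × Fin d) ℂ) :
    Matrix (Fin d) (Fin d) ℂ :=
  Matrix.of fun o o' => ∑ i : Fin d, N (i, o) (i, o')

theorem ptrOut_add {d : ℕ} (M N : Matrix (Fin d × Fin d) (Fin d × Fin d) ℂ) :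
    ptrOut (M + N) = ptrOut M + ptrOut N := by
  ext i j
  simp [ptrOut, Finset.sum_add_distrib]

theorem ptrIn_add {d : ℕ} (M N : Matrix (Fin d × Fin d) (Fin d × Fin d) ℂ) :
    ptrIn (M + N) = ptrIn M + ptrIn N := by
  ext i j
  simp [ptrIn, Finset.sum_add_distrib]

theorem ptrOut_smul {d : ℕ} (c : ℂ) (M : Matrix (Fin d × Fin d) (Fin d × Fin d) ℂ) :
    ptrOut (c • M) = c • ptrOut M := by
  ext i j
  simp [ptrOut, Finset.mul_sum]

theorem ptrIn_smul {d : ℕ} (c : ℂ) (M : Matrix (Fin d × Fin d) (Fin d × Fin d) ℂ) :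
    ptrIn (c • M) = c • ptrIn M := by
  ext i j
  simp [ptrIn, Finset.mul_sum]

theorem ptrOut_kronecker {d : ℕ} (A B : Matrix (Fin d) (Fin d) ℂ) :
    ptrOut (A ⊗ₖ B) = B.trace • A := by
  ext i j
  simp [ptrOut, Matrix.trace, ← Finset.mul_sum, mul_comm]

theorem ptrIn_kronecker {d : ℕ} (A B : Matrix (Fin d) (Fin d) ℂ) :
    ptrIn (A ⊗ₖ B) = A.trace • B := by
  ext i j
  simp [ptrIn, Matrix.trace, ← Finset.sum_mul]

/-- A matrix with vanishing partial traces is a sum of Kronecker products of traceless matrices: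
subtract the trace part from each matrix unit in its block expansion. -/
theorem eq_sum_kronecker_of_ptr_eq_zero {d : ℕ} {M : Matrix (Fin d × Fin d) (Fin d × Fin d) ℂ}
    (hM : ptrIn M = 0) :
    M = ∑ i, ∑ j, (single i j (1 : ℂ) - ((single i j (1 : ℂ)).trace / d) • 1) ⊗ₖ
      (of fun o o' => M (i, o) (j, o')) := by
  ext ⟨i, o⟩ ⟨j, o'⟩
  have h : ∑ k, M (k, o) (k, o') = 0 := congrFun (congrFun hM o) o'
  have htrace (k l : Fin d) : (single k l (1 : ℂ)).trace = if k = l then 1 else 0 := by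
    split_ifs with hkl
    · subst hkl
      exact trace_single_eq_same k 1
    · exact trace_single_eq_of_ne k l 1 hkl
  simp only [Matrix.sum_apply, kroneckerMap_apply, Matrix.sub_apply, Matrix.smul_apply, of_apply, htrace,
    sub_mul, Finset.sum_sub_distrib, smul_eq_mul, single_apply]
  simp [ite_and, ite_div, ← Finset.mul_sum, h]

theorem mem_span_traceless_kronecker_iff {d : ℕ} (hd : 1 ≤ d)
    (M : Matrix (Fin d × Fin d) (Fin d × Fin d) ℂ) :
    M ∈ Submodule.span ℂ {K : Matrix (Fin d × Fin d) (Fin d × Fin d) ℂ |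
        ∃ (A : Matrix (Fin d) (Fin d) ℂ) (B : Matrix (Fin d) (Fin d) ℂ),
          A.trace = 0 ∧ B.trace = 0 ∧ K = A ⊗ₖ B} ↔
    ptrOut M = 0 ∧ ptrIn M = 0 := by
  constructor
  · intro h
    induction h using Submodule.span_induction with
    | mem x hx =>
      obtain ⟨A, B, hA, hB, rfl⟩ := hx
      simp [ptrOut_kronecker, ptrIn_kronecker, hA, hB]
    | zero => constructor <;> ext <;> simp [ptrOut, ptrIn]
    | add x y _ _ hx hy => simp [ptrOut_add, ptrIn_add, hx, hy]
    | smul c x _ hx => simp [ptrOut_smul, ptrIn_smul, hx]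
  · rintro ⟨hout, hin⟩
    have hd' : (d : ℂ) ≠ 0 := by exact_mod_cast Nat.one_le_iff_ne_zero.mp hd
    rw [eq_sum_kronecker_of_ptr_eq_zero hin]
    refine Submodule.sum_mem _ fun i _ => Submodule.sum_mem _ fun j _ =>
      Submodule.subset_span ⟨_, of fun o o' => M (i, o) (j, o'), ?_,
        congrFun (congrFun hout i) j, rfl⟩
    simp [trace_sub, trace_smul, hd']

/-- A matrix `N` on `H_in ⊗ H_out` (both of dimension `d ≥ 1`) satisfies the
partial-trace conditions `Tr_out(N) = I_in` and `Tr_in(N) = I_out` of the Choi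
operator of a bistochastic channel if and only if
`N = (1/d)·(I ⊗ I) + M` with `M` in the linear span of Kronecker products of
traceless matrices. -/
theorem bistochastic_choi_decomposition {d : ℕ} (hd : 1 ≤ d)
    (N : Matrix (Fin d × Fin d) (Fin d × Fin d) ℂ) :
    (ptrOut N = 1 ∧ ptrIn N = 1) ↔
    ∃ M ∈ Submodule.span ℂ {K : Matrix (Fin d × Fin d) (Fin d × Fin d) ℂ |
        ∃ (A : Matrix (Fin d) (Fin d) ℂ) (B : Matrix (Fin d) (Fin d) ℂ),
          A.trace = 0 ∧ B.trace = 0 ∧ K = A ⊗ₖ B},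
      N = ((d : ℂ))⁻¹ • ((1 : Matrix (Fin d) (Fin d) ℂ) ⊗ₖ (1 : Matrix (Fin d) (Fin d) ℂ)) + M := by
  have hd' : (d : ℂ) ≠ 0 := by exact_mod_cast Nat.one_le_iff_ne_zero.mp hd
  have hout : ptrOut ((d : ℂ)⁻¹ •
      ((1 : Matrix (Fin d) (Fin d) ℂ) ⊗ₖ (1 : Matrix (Fin d) (Fin d) ℂ))) = 1 := by
    rw [ptrOut_smul, ptrOut_kronecker, smul_smul]
    simp [hd']
  have hin : ptrIn ((d : ℂ)⁻¹ •
      ((1 : Matrix (Fin d) (Fin d) ℂ) ⊗ₖ (1 : Matrix (Fin d) (Fin d) ℂ))) = 1 := by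
    rw [ptrIn_smul, ptrIn_kronecker, smul_smul]
    simp [hd']
  simp only [mem_span_traceless_kronecker_iff hd]
  constructor
  · rintro ⟨h₁, h₂⟩
    refine ⟨N - (d : ℂ)⁻¹ • (1 ⊗ₖ 1), ⟨?_, ?_⟩, (add_sub_cancel _ _).symm⟩
    · rw [← add_right_inj (1 : Matrix (Fin d) (Fin d) ℂ), add_zero]
      nth_rw 1 [← hout]
      rw [← ptrOut_add, add_sub_cancel, h₁]
    · rw [← add_right_inj (1 : Matrix (Fin d) (Fin d) ℂ), add_zero]
      nth_rw 1 [← hin]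
      rw [← ptrIn_add, add_sub_cancel, h₂]
  · rintro ⟨M, ⟨h₁, h₂⟩, rfl⟩
    rw [ptrOut_add, ptrIn_add, hout, hin, h₁, h₂, add_zero]
    exact ⟨rfl, rfl⟩
end

section
/- Let U and V be d×d unitary matrices satisfying U·Vᵀ = ε·Uᵀ·V for a sign ε ∈ {+1, −1}. Then the matrices U·Vᵀ + Vᵀ·U and U·Vᵀ − Vᵀ·U are orthogonal in the Hilbert–Schmidt inner product: Tr[ (U·Vᵀ + Vᵀ·U)ᴴ · (U·Vᵀ − Vᵀ·U) ] = 0. -/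
open Matrix

/-- Let `U` and `V` be `d×d` unitary matrices satisfying `U·Vᵀ = ε·Uᵀ·V` for a sign
`ε ∈ {+1, −1}`. Then `U·Vᵀ + Vᵀ·U` and `U·Vᵀ − Vᵀ·U` are orthogonal in the
Hilbert–Schmidt inner product: `Tr[(U·Vᵀ + Vᵀ·U)ᴴ · (U·Vᵀ − Vᵀ·U)] = 0`. -/
theorem hilbert_schmidt_orthogonal {d : ℕ} (U V : Matrix (Fin d) (Fin d) ℂ)
    (hU : Uᴴ * U = 1 ∧ U * Uᴴ = 1) (hV : Vᴴ * V = 1 ∧ V * Vᴴ = 1)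
    (ε : ℂ) (hε : ε = 1 ∨ ε = -1) (hrel : U * Vᵀ = ε • (Uᵀ * V)) :
    ((U * Vᵀ + Vᵀ * U)ᴴ * (U * Vᵀ - Vᵀ * U)).trace = 0 := by
  have hrelT : V * Uᵀ = ε • (Vᵀ * U) := by
    simpa using congrArg transpose hrel
  have hswap : (U * Vᵀ)ᴴ * (Vᵀ * U) = (Uᵀ * V)ᴴ * (V * Uᵀ) := by
    rw [hrelT, hrel]
    rcases hε with rfl | rfl <;> simp
  have hcross : ((U * Vᵀ)ᴴ * (Vᵀ * U)).trace = ((Vᵀ * U)ᴴ * (U * Vᵀ)).trace := by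
    have hT : ((Uᵀ * V)ᴴ * (V * Uᵀ))ᵀ = (U * Vᵀ) * (Vᵀ * U)ᴴ := by
      simp only [transpose_mul, conjTranspose_mul, transpose_transpose]
      rfl
    rw [hswap, ← trace_transpose, hT, trace_mul_comm]
  have hnorm : ((U * Vᵀ)ᴴ * (U * Vᵀ)).trace = ((Vᵀ * U)ᴴ * (Vᵀ * U)).trace := by
    have hA : (U * Vᵀ)ᴴ * (U * Vᵀ) = Vᵀᴴ * Vᵀ := by
      rw [conjTranspose_mul, Matrix.mul_assoc, ← Matrix.mul_assoc Uᴴ, hU.1, Matrix.one_mul]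
    have hB : (Vᵀ * U)ᴴ * (Vᵀ * U) = Uᴴ * (Vᵀᴴ * Vᵀ * U) := by
      simp only [conjTranspose_mul, Matrix.mul_assoc]
    rw [hA, hB, trace_mul_comm Uᴴ, Matrix.mul_assoc, hU.2, Matrix.mul_one]
  rw [conjTranspose_add, Matrix.add_mul, Matrix.mul_sub, Matrix.mul_sub, trace_add,
    trace_sub, trace_sub, hcross, hnorm]
  ring
end
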